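/- (Hartshorne–Lichtenbaum Vanishing) Let (A,m) be a commutative Noetherian local ring of Krull dimension d and let I be a proper ideal of A. Then H^d_I(A) = 0 (equivalently, lcd_A(I) ≤ d − 1) if and only if dim(Â/(IÂ + P)) > 0 for every minimal prime P of the m-adic completion Â with dim(Â/P) = d. In particular, if A is a complete local domain and √I ≠ m, then H^d_I(A) = 0. -/

import Mathlib

open CategoryTheory

namespace HartshorneLichtenbaum

section

open CategoryTheory.Abelian

section Stages

variable {A : Type} [CommRing A] (I : Ideal A)

/-- The projection `A ⧸ I ^ m ⟶ A ⧸ I ^ n` for `n ≤ m`. -/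
noncomputable def powProj {n m : ℕ} (h : n ≤ m) :
    ModuleCat.of A (A ⧸ I ^ m) ⟶ ModuleCat.of A (A ⧸ I ^ n) :=
  ModuleCat.ofHom (Ideal.Quotient.factorₐ A (Ideal.pow_le_pow_right h)).toLinearMap

lemma powProj_refl (n : ℕ) : powProj I (le_refl n) = 𝟙 _ := by
  ext
  rfl

lemma powProj_comp {n m l : ℕ} (h : n ≤ m) (h' : m ≤ l) :
    powProj I h' ≫ powProj I h = powProj I (h.trans h') := by
  ext
  rfl

/-- The transition maps of the system `n ↦ Ext (A ⧸ I ^ n, M)`. -/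
noncomputable def trans (j : ℕ) (M : ModuleCat.{0} A) (n m : ℕ) (h : n ≤ m) :
    Ext (ModuleCat.of A (A ⧸ I ^ n)) M j →+ Ext (ModuleCat.of A (A ⧸ I ^ m)) M j where
  toFun x := (Ext.mk₀ (powProj I h)).comp x (zero_add j)
  map_zero' := by simp
  map_add' := by simp

lemma trans_apply (j : ℕ) (M : ModuleCat.{0} A) (n m : ℕ) (h : n ≤ m)
    (x : Ext (ModuleCat.of A (A ⧸ I ^ n)) M j) :
    trans I j M n m h x = (Ext.mk₀ (powProj I h)).comp x (zero_add j) := rfl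

instance (j : ℕ) (M : ModuleCat.{0} A) :
    DirectedSystem (fun n : ℕ => Ext (ModuleCat.of A (A ⧸ I ^ n)) M j)
      (fun n m h => trans I j M n m h) where
  map_self n x := by simp [trans_apply, powProj_refl]
  map_map k n m hkn hnm x := by
    simp [trans_apply, ← powProj_comp I hkn hnm]

/-- The `j`-th local cohomology of `M` with support in `I`, as a colimit of `Ext` groups. -/
def LC (j : ℕ) (M : ModuleCat.{0} A) : Type :=
  AddCommGroup.DirectLimit (fun n : ℕ => Ext (ModuleCat.of A (A ⧸ I ^ n)) M j) (trans I j M)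

noncomputable instance (j : ℕ) (M : ModuleCat.{0} A) : AddCommGroup (LC I j M) :=
  inferInstanceAs (AddCommGroup (AddCommGroup.DirectLimit _ _))

/-- The structure maps of the colimit `LC`. -/
noncomputable def LC.of (j : ℕ) (M : ModuleCat.{0} A) (n : ℕ) :
    Ext (ModuleCat.of A (A ⧸ I ^ n)) M j →+ LC I j M :=
  AddCommGroup.DirectLimit.of (fun n : ℕ => Ext (ModuleCat.of A (A ⧸ I ^ n)) M j) (trans I j M) n

variable {I}

lemma LC.exists_of {j : ℕ} {M : ModuleCat.{0} A} (x : LC I j M) :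
    ∃ n c, LC.of I j M n c = x :=
  AddCommGroup.DirectLimit.induction_on (f := trans I j M)
    (C := fun x => ∃ n c, LC.of I j M n c = x) x (fun n c => ⟨n, c, rfl⟩)

lemma LC.of_trans {j : ℕ} {M : ModuleCat.{0} A} {n m : ℕ} (h : n ≤ m)
    (c : Ext (ModuleCat.of A (A ⧸ I ^ n)) M j) :
    LC.of I j M m (trans I j M n m h c) = LC.of I j M n c :=
  AddCommGroup.DirectLimit.of_f (f := trans I j M) h c

lemma LC.of_eq_zero_iff {j : ℕ} {M : ModuleCat.{0} A} {n : ℕ}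
    (c : Ext (ModuleCat.of A (A ⧸ I ^ n)) M j) :
    LC.of I j M n c = 0 ↔ ∃ (m : ℕ) (h : n ≤ m), trans I j M n m h c = 0 := by
  constructor
  · intro hc
    exact AddCommGroup.DirectLimit.of.zero_exact
      (G := fun n : ℕ => Ext (ModuleCat.of A (A ⧸ I ^ n)) M j) (f := trans I j M) n c hc
  · rintro ⟨m, h, hc⟩
    rw [← LC.of_trans h, hc, map_zero]

/-- Postcomposition with an `Ext` class on local cohomology. -/
noncomputable def LC.post {j : ℕ} {M N : ModuleCat.{0} A} {a : ℕ} (e : Ext M N a) {k : ℕ}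
    (hk : j + a = k) : LC I j M →+ LC I k N :=
  AddCommGroup.DirectLimit.map (f := trans I j M) (f' := trans I k N)
    (fun _ => e.postcomp _ hk) (by
      intro n m h
      ext x
      simp only [AddMonoidHom.comp_apply, trans_apply, AddMonoidHom.flip_apply,
        Ext.bilinearComp_apply_apply]
      exact Ext.comp_assoc _ _ _ _ _ (by lia))

lemma LC.post_of {j : ℕ} {M N : ModuleCat.{0} A} {a : ℕ} (e : Ext M N a) {k : ℕ}
    (hk : j + a = k) (n : ℕ) (c : Ext (ModuleCat.of A (A ⧸ I ^ n)) M j) :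
    LC.post e hk (LC.of I j M n c) = LC.of I k N n (c.comp e hk) :=
  AddCommGroup.DirectLimit.map_apply_of (f := trans I j M) (f' := trans I k N) _ _ c

lemma LC.post_post {j : ℕ} {M N P : ModuleCat.{0} A} {a b k l c : ℕ} (e : Ext M N a)
    (e' : Ext N P b) (hk : j + a = k) (hl : k + b = l) (hc : a + b = c) (x : LC I j M) :
    LC.post e' hl (LC.post e hk x) = LC.post (e.comp e' hc) (by lia) x := by
  obtain ⟨n, x, rfl⟩ := x.exists_of
  rw [LC.post_of, LC.post_of, LC.post_of, Ext.comp_assoc _ _ _ hk hc (by lia)]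

lemma LC.post_add {j : ℕ} {M N : ModuleCat.{0} A} {a : ℕ} (e e' : Ext M N a) {k : ℕ}
    (hk : j + a = k) (x : LC I j M) :
    LC.post (e + e') hk x = LC.post e hk x + LC.post e' hk x := by
  obtain ⟨n, x, rfl⟩ := x.exists_of
  rw [LC.post_of, LC.post_of, LC.post_of, Ext.comp_add, map_add]

lemma LC.post_zero {j : ℕ} {M N : ModuleCat.{0} A} {a : ℕ} {k : ℕ}
    (hk : j + a = k) (x : LC I j M) : LC.post (0 : Ext M N a) hk x = 0 := by
  obtain ⟨n, x, rfl⟩ := x.exists_of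
  rw [LC.post_of, Ext.comp_zero, map_zero]

lemma LC.post_id {j : ℕ} {M : ModuleCat.{0} A} (x : LC I j M) :
    LC.post (Ext.mk₀ (𝟙 M)) (add_zero j) x = x := by
  obtain ⟨n, x, rfl⟩ := x.exists_of
  rw [LC.post_of, Ext.comp_mk₀_id]

section Exact

variable {S : ShortComplex (ModuleCat.{0} A)} (hS : S.ShortExact)
include hS

lemma LC.exact₂ {j : ℕ} (x : LC I j S.X₂) (hx : LC.post (Ext.mk₀ S.g) (add_zero j) x = 0) :
    ∃ y : LC I j S.X₁, LC.post (Ext.mk₀ S.f) (add_zero j) y = x := by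
  obtain ⟨n, x, rfl⟩ := x.exists_of
  rw [LC.post_of, LC.of_eq_zero_iff] at hx
  obtain ⟨m, h, hx⟩ := hx
  obtain ⟨y, hy⟩ := Ext.covariant_sequence_exact₂ _ hS (trans I j _ n m h x) (by
    rw [← hx, trans_apply, trans_apply]; exact Ext.comp_assoc _ _ _ _ _ (by lia))
  exact ⟨LC.of I j _ m y, by rw [LC.post_of, hy, LC.of_trans]⟩

lemma LC.exact₃ {j k : ℕ} (hk : j + 1 = k) (x : LC I j S.X₃)
    (hx : LC.post hS.extClass hk x = 0) :
    ∃ y : LC I j S.X₂, LC.post (Ext.mk₀ S.g) (add_zero j) y = x := by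
  obtain ⟨n, x, rfl⟩ := x.exists_of
  rw [LC.post_of, LC.of_eq_zero_iff] at hx
  obtain ⟨m, h, hx⟩ := hx
  obtain ⟨y, hy⟩ := Ext.covariant_sequence_exact₃ _ hS (trans I j _ n m h x) hk (by
    rw [← hx, trans_apply, trans_apply]; exact Ext.comp_assoc _ _ _ _ _ (by lia))
  exact ⟨LC.of I j _ m y, by rw [LC.post_of, hy, LC.of_trans]⟩

lemma LC.exact₁ {j k : ℕ} (hk : j + 1 = k) (x : LC I k S.X₁)
    (hx : LC.post (Ext.mk₀ S.f) (add_zero k) x = 0) :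
    ∃ y : LC I j S.X₃, LC.post hS.extClass hk y = x := by
  obtain ⟨n, x, rfl⟩ := x.exists_of
  rw [LC.post_of, LC.of_eq_zero_iff] at hx
  obtain ⟨m, h, hx⟩ := hx
  obtain ⟨y, hy⟩ := Ext.covariant_sequence_exact₁ _ hS (trans I k _ n m h x) (by
    rw [← hx, trans_apply, trans_apply]; exact Ext.comp_assoc _ _ _ _ _ (by lia)) hk
  exact ⟨LC.of I j _ m y, by rw [LC.post_of, hy, LC.of_trans]⟩

lemma LC.post_extClass_f {j k : ℕ} (hk : j + 1 = k) (x : LC I j S.X₃) :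
    LC.post (Ext.mk₀ S.f) (add_zero k) (LC.post hS.extClass hk x) = 0 := by
  rw [LC.post_post _ _ _ _ (add_zero 1), hS.extClass_comp]
  exact LC.post_zero _ x

lemma LC.post_g_extClass {j k : ℕ} (hk : j + 1 = k) (x : LC I j S.X₂) :
    LC.post hS.extClass hk (LC.post (Ext.mk₀ S.g) (add_zero j) x) = 0 := by
  rw [LC.post_post _ _ _ _ (zero_add 1), hS.comp_extClass]
  exact LC.post_zero _ x

end Exact

lemma LC.exists_connecting {X₁ X₂ X₃ : ModuleCat.{0} A} (f : X₁ ⟶ X₂) (g : X₂ ⟶ X₃)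
    (w : f ≫ g = 0) (hS : (ShortComplex.mk f g w).ShortExact) (j : ℕ) :
    ∃ δ : LC I j X₃ →+ LC I (j + 1) X₁,
      (∀ x, δ x = 0 ↔ ∃ y, LC.post (Ext.mk₀ g) (add_zero j) y = x) ∧
      (∀ x, LC.post (Ext.mk₀ f) (add_zero (j + 1)) x = 0 ↔ ∃ y, δ y = x) ∧
      ∀ (t₁ : X₁ ⟶ X₁) (t₂ : X₂ ⟶ X₂) (t₃ : X₃ ⟶ X₃), t₁ ≫ f = f ≫ t₂ → t₂ ≫ g = g ≫ t₃ →
        ∀ x, δ (LC.post (Ext.mk₀ t₃) (add_zero j) x) =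
          LC.post (Ext.mk₀ t₁) (add_zero (j + 1)) (δ x) := by
  refine ⟨LC.post (I := I) hS.extClass rfl, fun x => ⟨LC.exact₃ hS rfl x, ?_⟩,
    fun x => ⟨LC.exact₁ hS rfl x, ?_⟩, fun t₁ t₂ t₃ h₁ h₂ x => ?_⟩
  · rintro ⟨y, rfl⟩
    exact LC.post_g_extClass hS rfl y
  · rintro ⟨y, rfl⟩
    exact LC.post_extClass_f hS rfl y
  · rw [LC.post_post _ _ _ _ (zero_add 1), LC.post_post _ _ _ _ (add_zero 1)]
    have := ShortComplex.ShortExact.extClass_naturality hS hS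
      { τ₁ := t₁, τ₂ := t₂, τ₃ := t₃, comm₁₂ := h₁, comm₂₃ := h₂ }
    dsimp only at this
    rw [this]

end Stages

end

section

open CategoryTheory.Abelian

section Torsion

variable {A : Type} [CommRing A] {I : Ideal A}

lemma LC.exists_pow_smul_eq_zero {j : ℕ} {M : ModuleCat.{0} A} (x : LC I j M) :
    ∃ n, ∀ a ∈ I ^ n, LC.post (Ext.mk₀ (a • 𝟙 M)) (add_zero j) x = 0 := by
  obtain ⟨n, x, rfl⟩ := x.exists_of
  refine ⟨n, fun a ha => ?_⟩
  have h0 : a • 𝟙 (ModuleCat.of A (A ⧸ I ^ n)) = 0 := by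
    ext
    change (Ideal.Quotient.mk (I ^ n) (a • 1)) = 0
    rw [Ideal.Quotient.eq_zero_iff_mem, smul_eq_mul, mul_one]
    exact ha
  have : x.comp (Ext.mk₀ (a • 𝟙 M)) (add_zero j) = 0 := by
    rw [← Ext.smul_eq_comp_mk₀]
    have h1 : (Ext.mk₀ (a • 𝟙 (ModuleCat.of A (A ⧸ I ^ n)))).comp x (zero_add j) = a • x := by
      rw [Ext.mk₀_smul, Ext.smul_comp, Ext.mk₀_id_comp]
    rw [← h1, h0, Ext.mk₀_zero, Ext.zero_comp]
  rw [LC.post_of, this, map_zero]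

/-- Evaluation at `1` identifies `H⁰` with a submodule. -/
noncomputable def LC.ev (I : Ideal A) (M : ModuleCat.{0} A) : LC I 0 M →+ M :=
  AddCommGroup.DirectLimit.lift _ (trans I 0 M) _
    (fun n =>
      { toFun := fun x => (Ext.addEquiv₀ x).hom (1 : A ⧸ I ^ n)
        map_zero' := by simp
        map_add' := by simp })
    (by
      intro n m h x
      obtain ⟨f, rfl⟩ := Ext.addEquiv₀.symm.surjective x
      have : trans I 0 M n m h (Ext.addEquiv₀.symm f) = Ext.addEquiv₀.symm (powProj I h ≫ f) := by
        rw [trans_apply]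
        exact Ext.mk₀_comp_mk₀ _ _
      rw [this]
      simp only [AddMonoidHom.coe_mk, ZeroHom.coe_mk, AddEquiv.apply_symm_apply]
      rfl)

lemma LC.ev_of_mk₀ {M : ModuleCat.{0} A} (n : ℕ) (f : ModuleCat.of A (A ⧸ I ^ n) ⟶ M) :
    LC.ev I M (LC.of I 0 M n (Ext.mk₀ f)) = f.hom (1 : A ⧸ I ^ n) := by
  refine (AddCommGroup.DirectLimit.lift_of (f := trans I 0 M) _ _ _ _ _).trans ?_
  have : Ext.addEquiv₀ (Ext.mk₀ f) = f := Ext.addEquiv₀.apply_symm_apply f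
  simp only [AddMonoidHom.coe_mk, ZeroHom.coe_mk, this]

lemma LC.exists_of_mk₀ {M : ModuleCat.{0} A} (x : LC I 0 M) :
    ∃ (n : ℕ) (f : ModuleCat.of A (A ⧸ I ^ n) ⟶ M), x = LC.of I 0 M n (Ext.mk₀ f) := by
  obtain ⟨n, c, rfl⟩ := x.exists_of
  obtain ⟨f, rfl⟩ := Ext.addEquiv₀.symm.surjective c
  exact ⟨n, f, rfl⟩

lemma LC.ev_injective (M : ModuleCat.{0} A) : Function.Injective (LC.ev I M) := by
  rw [injective_iff_map_eq_zero]
  intro x hx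
  obtain ⟨n, f, rfl⟩ := x.exists_of_mk₀
  rw [LC.ev_of_mk₀] at hx
  have : f = 0 := by
    ext
    exact hx
  rw [this, Ext.mk₀_zero, map_zero]

lemma LC.ev_post {M N : ModuleCat.{0} A} (g : M ⟶ N) (x : LC I 0 M) :
    LC.ev I N (LC.post (Ext.mk₀ g) (add_zero 0) x) = g.hom (LC.ev I M x) := by
  obtain ⟨n, f, rfl⟩ := x.exists_of_mk₀
  rw [LC.post_of, Ext.mk₀_comp_mk₀, LC.ev_of_mk₀, LC.ev_of_mk₀]
  rfl

lemma LC.exists_ev_eq {M : ModuleCat.{0} A} (x : M) (n : ℕ) (hx : ∀ a ∈ I ^ n, a • x = 0) :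
    ∃ t, LC.ev I M t = x := by
  refine ⟨LC.of I 0 M n (Ext.mk₀ (ModuleCat.ofHom
    ((I ^ n).liftQ (LinearMap.toSpanSingleton A M x) (fun a ha => hx a ha)))), ?_⟩
  rw [LC.ev_of_mk₀]
  exact one_smul A x

end Torsion

section Injective

variable {A : Type} [CommRing A]

lemma exists_comp_eq_of_ker_le {R : Type*} [CommRing R] {Q : Type*} [AddCommGroup Q] [Module R Q]
    (hQ : Module.Baer R Q) {X Y : Type*}
    [AddCommGroup X] [Module R X] [AddCommGroup Y] [Module R Y]
    (g : X →ₗ[R] Y) (f : X →ₗ[R] Q) (h : LinearMap.ker g ≤ LinearMap.ker f) :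
    ∃ k : Y →ₗ[R] Q, k ∘ₗ g = f := by
  obtain ⟨k, hk⟩ := hQ.extension_property ((LinearMap.ker g).liftQ g le_rfl)
    (by rw [← LinearMap.ker_eq_bot]; exact Submodule.ker_liftQ_eq_bot _ _ _ le_rfl)
    ((LinearMap.ker g).liftQ f h)
  refine ⟨k, ?_⟩
  ext x
  exact LinearMap.congr_fun hk (Submodule.Quotient.mk x)

/-- The `I`-power torsion submodule. -/
def torsionPart (I : Ideal A) (M : Type) [AddCommGroup M] [Module A M] : Submodule A M where
  carrier := {x | ∃ n, ∀ a ∈ I ^ n, a • x = 0}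
  zero_mem' := ⟨0, fun _ _ => smul_zero _⟩
  add_mem' := by
    rintro x y ⟨n, hn⟩ ⟨m, hm⟩
    refine ⟨n + m, fun a ha => ?_⟩
    rw [smul_add, hn a (Ideal.pow_le_pow_right (by lia) ha),
      hm a (Ideal.pow_le_pow_right (by lia) ha), add_zero]
  smul_mem' := by
    rintro c x ⟨n, hn⟩
    exact ⟨n, fun a ha => by rw [smul_comm, hn a ha, smul_zero]⟩

lemma exists_pow_of_le_torsionPart {I : Ideal A} {M : Type} [AddCommGroup M] [Module A M]
    (N : Submodule A M) (hN : N.FG) (h : N ≤ torsionPart I M) :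
    ∃ n, ∀ a ∈ I ^ n, ∀ x ∈ N, a • x = 0 := by
  induction N, hN using Submodule.fg_induction with
  | singleton x =>
    obtain ⟨n, hn⟩ := h (Submodule.mem_span_singleton_self x)
    refine ⟨n, fun a ha y hy => ?_⟩
    obtain ⟨c, rfl⟩ := Submodule.mem_span_singleton.1 hy
    rw [smul_comm, hn a ha, smul_zero]
  | sup N₁ N₂ _ _ h₁ h₂ =>
    obtain ⟨n, hn⟩ := h₁ (le_sup_left.trans h)
    obtain ⟨m, hm⟩ := h₂ (le_sup_right.trans h)
    refine ⟨n + m, fun a ha y hy => ?_⟩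
    obtain ⟨y, hy', z, hz, rfl⟩ := Submodule.mem_sup.1 hy
    rw [smul_add, hn a (Ideal.pow_le_pow_right (by lia) ha) y hy',
      hm a (Ideal.pow_le_pow_right (by lia) ha) z hz, add_zero]

lemma baer_torsionPart [IsNoetherianRing A] (I : Ideal A) {Q : Type} [AddCommGroup Q] [Module A Q]
    (hQ : Module.Baer A Q) : Module.Baer A (torsionPart I Q) := by
  intro J f
  obtain ⟨n, hn⟩ := exists_pow_of_le_torsionPart (I := I)
    (LinearMap.range ((torsionPart I Q).subtype ∘ₗ f))
    ((Submodule.fg_top _).1 (Module.Finite.fg_top)) (by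
      rintro _ ⟨x, rfl⟩
      exact (f x).2)
  obtain ⟨k, hk⟩ := Ideal.exists_pow_inf_eq_pow_smul (M := A) I J
  have hker : LinearMap.ker ((I ^ (n + k)).mkQ ∘ₗ J.subtype) ≤
      LinearMap.ker ((torsionPart I Q).subtype ∘ₗ f) := by
    intro x hx
    have hx' : (x : A) ∈ I ^ (n + k) := by
      simpa [Ideal.Quotient.eq_zero_iff_mem] using hx
    have h1 : (x : A) ∈ I ^ n • J := by
      have : (x : A) ∈ I ^ (n + k) • (⊤ : Submodule A A) ⊓ J := ⟨by simpa using hx', x.2⟩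
      rw [hk (n + k) (by lia)] at this
      exact Submodule.smul_mono (Ideal.pow_le_pow_right (by lia)) inf_le_right this
    have h2 : ∀ y ∈ I ^ n • J, ∀ hy : y ∈ J, ((f ⟨y, hy⟩ : torsionPart I Q) : Q) = 0 := by
      intro y hy
      induction hy using Submodule.smul_induction_on' with
      | smul r hr m hm =>
        intro _
        have := hn r hr _ ⟨⟨m, hm⟩, rfl⟩
        rw [← map_smul] at this
        exact this
      | add y hy z hz h₁ h₂ =>
        intro _
        have hy' : y ∈ J := Submodule.smul_le_right hy
        have hz' : z ∈ J := Submodule.smul_le_right hz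
        have := congrArg₂ (· + ·) (h₁ hy') (h₂ hz')
        simp only [add_zero] at this
        rw [← Submodule.coe_add, ← map_add] at this
        exact this
    exact h2 x h1 x.2
  obtain ⟨g, hg⟩ := exists_comp_eq_of_ker_le hQ _ _ hker
  have htor : ∀ a : A, g ((I ^ (n + k)).mkQ a) ∈ torsionPart I Q := by
    intro a
    refine ⟨n + k, fun b hb => ?_⟩
    rw [← map_smul, ← map_smul, Submodule.mkQ_apply, (Submodule.Quotient.mk_eq_zero _).2, map_zero]
    exact Ideal.mul_mem_right _ _ hb
  refine ⟨(g ∘ₗ (I ^ (n + k)).mkQ).codRestrict _ htor, fun x hx => ?_⟩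
  apply Subtype.ext
  exact LinearMap.congr_fun hg ⟨x, hx⟩

end Injective

section Vanishing

variable {A : Type} [CommRing A] {I : Ideal A}

/-- The short exact sequence attached to an injection `f` and a surjection `g`. -/
lemma shortExact_of {M N P : ModuleCat.{0} A} (f : M →ₗ[A] N) (g : N →ₗ[A] P)
    (hf : Function.Injective f) (hg : Function.Surjective g) (h : Function.Exact f g) :
    (ShortComplex.mk (ModuleCat.ofHom f) (ModuleCat.ofHom g)
      (by ext x; exact h.apply_apply_eq_zero x)).ShortExact where
  exact := by
    rw [ShortComplex.moduleCat_exact_iff]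
    intro x hx
    exact (h x).1 hx
  mono_f := (ModuleCat.mono_iff_injective _).2 hf
  epi_g := (ModuleCat.epi_iff_surjective _).2 hg

lemma LC.subsingleton_of_injective {Q : ModuleCat.{0} A} (hQ : Injective Q) {j : ℕ} (hj : 0 < j) :
    Subsingleton (LC I j Q) := by
  obtain ⟨j, rfl⟩ := Nat.exists_eq_succ_of_ne_zero hj.ne'
  refine subsingleton_of_forall_eq 0 fun x => ?_
  obtain ⟨n, c, rfl⟩ := x.exists_of
  rw [Ext.eq_zero_of_injective c, map_zero]

lemma exists_torsion_injective_embedding [IsNoetherianRing A] (M : ModuleCat.{0} A)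
    (hM : torsionPart I M = ⊤) : ∃ (Q : ModuleCat.{0} A) (f : M →ₗ[A] Q),
      Function.Injective f ∧ Injective Q ∧ torsionPart I Q = ⊤ := by
  let U : ModuleCat.{0} A := Injective.under M
  have hU : Module.Injective A U :=
    (Module.injective_iff_injective_object A U).2 (inferInstanceAs (Injective (Injective.under M)))
  have hB := baer_torsionPart I (Module.Baer.iff_injective.2 hU)
  have hι : Function.Injective (Injective.ι M).hom := (ModuleCat.mono_iff_injective _).1
    (inferInstance : Mono (Injective.ι M))
  refine ⟨ModuleCat.of A (torsionPart I U),
    (Injective.ι M).hom.codRestrict _ fun x => ?_, ?_,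
    (Module.injective_iff_injective_object A _).1 (Module.Baer.iff_injective.1 hB), ?_⟩
  · obtain ⟨n, hn⟩ : x ∈ torsionPart I M := hM ▸ Submodule.mem_top
    refine ⟨n, fun a ha => ?_⟩
    rw [← map_smul, hn a ha, map_zero]
  · intro x y h
    exact hι (congrArg Subtype.val h)
  · rw [eq_top_iff]
    rintro ⟨x, n, hn⟩ -
    exact ⟨n, fun a ha => Subtype.ext (hn a ha)⟩

lemma LC.subsingleton_of_torsion [IsNoetherianRing A] {j : ℕ} (hj : 0 < j) (M : ModuleCat.{0} A)
    (hM : torsionPart I M = ⊤) : Subsingleton (LC I j M) := by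
  obtain ⟨j, rfl⟩ := Nat.exists_eq_succ_of_ne_zero hj.ne'
  clear hj
  induction j generalizing M with
  | zero =>
    obtain ⟨Q, f, hf, hQ, hQ'⟩ := exists_torsion_injective_embedding M hM
    have hS := shortExact_of (P := ModuleCat.of A (Q ⧸ LinearMap.range f)) f
      (LinearMap.range f).mkQ hf (Submodule.mkQ_surjective _)
      (LinearMap.exact_map_mkQ_range f)
    refine subsingleton_of_forall_eq 0 fun x => ?_
    have := LC.subsingleton_of_injective (I := I) hQ Nat.one_pos
    obtain ⟨y, rfl⟩ := LC.exact₁ hS (Nat.zero_add 1) x (Subsingleton.elim _ _)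
    obtain ⟨q, hq⟩ := (LinearMap.range f).mkQ_surjective (LC.ev I _ y)
    obtain ⟨n, hn⟩ : q ∈ torsionPart I Q := hQ' ▸ Submodule.mem_top
    obtain ⟨t, ht⟩ := LC.exists_ev_eq q n hn
    have : y = LC.post (Ext.mk₀ (ModuleCat.ofHom (LinearMap.range f).mkQ)) (add_zero 0) t := by
      apply LC.ev_injective
      rw [LC.ev_post, ht, ← hq]
      rfl
    rw [this]
    exact LC.post_g_extClass hS _ t
  | succ j ih =>
    obtain ⟨Q, f, hf, hQ, hQ'⟩ := exists_torsion_injective_embedding M hM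
    have hS := shortExact_of (P := ModuleCat.of A (Q ⧸ LinearMap.range f)) f
      (LinearMap.range f).mkQ hf (Submodule.mkQ_surjective _)
      (LinearMap.exact_map_mkQ_range f)
    refine subsingleton_of_forall_eq 0 fun x => ?_
    have := LC.subsingleton_of_injective (I := I) hQ (Nat.succ_pos (j + 1))
    have := ih (ModuleCat.of A (Q ⧸ LinearMap.range f)) (by
      rw [eq_top_iff]
      rintro x -
      obtain ⟨q, rfl⟩ := (LinearMap.range f).mkQ_surjective x
      obtain ⟨n, hn⟩ : q ∈ torsionPart I Q := hQ' ▸ Submodule.mem_top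
      exact ⟨n, fun a ha => by rw [← map_smul, hn a ha, map_zero]⟩)
    obtain ⟨y, rfl⟩ := LC.exact₁ hS rfl x (Subsingleton.elim _ _)
    rw [Subsingleton.elim y 0, map_zero]

end Vanishing

end

section

open CategoryTheory.Abelian

section BaseRing

variable {A : Type} [CommRing A] (I : Ideal A) (B : Type) [CommRing B] [Algebra A B]

/-- A `B`-module viewed as an `A`-module. -/
noncomputable abbrev rs (A : Type) [CommRing A] {B : Type} [CommRing B] [Algebra A B]
    (M : Type) [AddCommGroup M] [Module B M] : ModuleCat.{0} A :=
  (ModuleCat.restrictScalars (algebraMap A B)).obj (ModuleCat.of B M)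

/-- A `B`-linear map viewed as an `A`-linear map. -/
noncomputable abbrev rsMap (A : Type) [CommRing A] {B : Type} [CommRing B] [Algebra A B]
    {M N : Type} [AddCommGroup M] [Module B M] [AddCommGroup N] [Module B N]
    (f : M →ₗ[B] N) : rs A (B := B) M ⟶ rs A (B := B) N :=
  (ModuleCat.restrictScalars (algebraMap A B)).map (ModuleCat.ofHom f)

/-- The local cohomology of a `B`-module with respect to an ideal of `A`, as a `B`-module. -/
def LCB (j : ℕ) (M : Type) [AddCommGroup M] [Module B M] : Type :=
  LC I j (rs A (B := B) M)

variable {M N P : Type} [AddCommGroup M] [Module B M] [AddCommGroup N] [Module B N]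
  [AddCommGroup P] [Module B P]

noncomputable instance (j : ℕ) : AddCommGroup (LCB I B j M) :=
  inferInstanceAs (AddCommGroup (LC I j (rs A (B := B) M)))

variable {B}

/-- Functoriality of local cohomology, additive version. -/
noncomputable def LCB.mapAdd {j : ℕ} (f : M →ₗ[B] N) : LCB I B j M →+ LCB I B j N :=
  LC.post (Ext.mk₀ (rsMap A f)) (add_zero j)

variable {I}

lemma LCB.mapAdd_add {j : ℕ} (f g : M →ₗ[B] N) (x : LCB I B j M) :
    LCB.mapAdd I (f + g) x = LCB.mapAdd I f x + LCB.mapAdd I g x := by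
  have : rsMap A (f + g) = rsMap A f + rsMap A g := rfl
  unfold LCB.mapAdd
  rw [this, Ext.mk₀_add]
  exact LC.post_add _ _ _ x

lemma LCB.mapAdd_zero {j : ℕ} (x : LCB I B j M) :
    LCB.mapAdd I (0 : M →ₗ[B] N) x = 0 := by
  have : rsMap A (0 : M →ₗ[B] N) = 0 := rfl
  unfold LCB.mapAdd
  rw [this, Ext.mk₀_zero]
  exact LC.post_zero _ x

lemma LCB.mapAdd_id {j : ℕ} (x : LCB I B j M) :
    LCB.mapAdd I (LinearMap.id : M →ₗ[B] M) x = x :=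
  LC.post_id x

lemma LCB.mapAdd_comp {j : ℕ} (g : N →ₗ[B] P) (f : M →ₗ[B] N) (x : LCB I B j M) :
    LCB.mapAdd I (g ∘ₗ f) x = LCB.mapAdd I g (LCB.mapAdd I f x) := by
  refine Eq.trans ?_ (LC.post_post _ _ _ _ (zero_add 0) x).symm
  rw [Ext.mk₀_comp_mk₀]
  rfl

noncomputable instance (j : ℕ) : Module B (LCB I B j M) where
  smul b x := LCB.mapAdd I (LinearMap.lsmul B M b) x
  one_smul x := by
    refine Eq.trans ?_ (LCB.mapAdd_id x)
    change LCB.mapAdd I _ x = _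
    congr 2
    ext x
    simp
  mul_smul a b x := by
    refine Eq.trans ?_ (LCB.mapAdd_comp _ _ x)
    change LCB.mapAdd I _ x = _
    congr 2
    ext x
    exact mul_smul a b x
  smul_zero b := map_zero _
  smul_add b := map_add _
  add_smul a b x := by
    refine Eq.trans ?_ (LCB.mapAdd_add _ _ x)
    change LCB.mapAdd I _ x = _
    rw [map_add]
  zero_smul x := by
    change LCB.mapAdd I _ x = _
    rw [map_zero, LCB.mapAdd_zero]

lemma LCB.smul_def {j : ℕ} (b : B) (x : LCB I B j M) :
    b • x = LCB.mapAdd I (LinearMap.lsmul B M b) x := rfl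

variable (I) in
/-- Functoriality of local cohomology. -/
noncomputable def LCB.map (j : ℕ) (f : M →ₗ[B] N) : LCB I B j M →ₗ[B] LCB I B j N where
  toFun := LCB.mapAdd I f
  map_add' := map_add _
  map_smul' b x := by
    simp only [LCB.smul_def, RingHom.id_apply, ← LCB.mapAdd_comp]
    congr 2
    ext x
    simp

lemma LCB.map_id (j : ℕ) : LCB.map I j (LinearMap.id : M →ₗ[B] M) = LinearMap.id :=
  LinearMap.ext LCB.mapAdd_id

lemma LCB.map_comp (j : ℕ) (g : N →ₗ[B] P) (f : M →ₗ[B] N) :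
    LCB.map I j (g ∘ₗ f) = LCB.map I j g ∘ₗ LCB.map I j f :=
  LinearMap.ext (LCB.mapAdd_comp g f)

lemma LCB.map_lsmul (j : ℕ) (b : B) (x : LCB I B j M) :
    LCB.map I j (LinearMap.lsmul B M b) x = b • x := rfl

variable (I) in
/-- Linear equivalences induce linear equivalences on local cohomology. -/
noncomputable def LCB.congr (j : ℕ) (e : M ≃ₗ[B] N) : LCB I B j M ≃ₗ[B] LCB I B j N :=
  LinearEquiv.ofLinearMap (LCB.map I j e.toLinearMap) (LCB.map I j e.symm.toLinearMap)
    (by rw [← LCB.map_comp, LinearEquiv.comp_symm, LCB.map_id])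
    (by rw [← LCB.map_comp, LinearEquiv.symm_comp, LCB.map_id])

section Exact

variable {f : M →ₗ[B] N} {g : N →ₗ[B] P} (hf : Function.Injective f) (hg : Function.Surjective g)
  (h : Function.Exact f g)
include hf hg h

lemma rs_shortExact : (ShortComplex.mk (rsMap A f) (rsMap A g)
    (by ext x; exact h.apply_apply_eq_zero x)).ShortExact where
  exact := by
    rw [ShortComplex.moduleCat_exact_iff]
    intro x hx
    exact (h x).1 hx
  mono_f := (ModuleCat.mono_iff_injective _).2 hf
  epi_g := (ModuleCat.epi_iff_surjective _).2 hg

lemma LCB.map_exact (j : ℕ) : Function.Exact (LCB.map I j f) (LCB.map I j g) := by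
  intro x
  constructor
  · intro hx
    exact LC.exact₂ (rs_shortExact (A := A) hf hg h) x hx
  · rintro ⟨y, rfl⟩
    rw [← LinearMap.comp_apply, ← LCB.map_comp, h.linearMap_comp_eq_zero]
    exact LCB.mapAdd_zero y

lemma LCB.exists_connecting (j : ℕ) : ∃ δ : LCB I B j P →ₗ[B] LCB I B (j + 1) M,
    Function.Exact (LCB.map I j g) δ ∧ Function.Exact δ (LCB.map I (j + 1) f) := by
  obtain ⟨δ, h₁, h₂, h₃⟩ := LC.exists_connecting (I := I) _ _ _ (rs_shortExact (A := A) hf hg h) j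
  refine ⟨{ toFun := δ, map_add' := map_add δ, map_smul' := fun b x => ?_ }, h₁, h₂⟩
  exact h₃ (rsMap A (LinearMap.lsmul B M b)) (rsMap A (LinearMap.lsmul B N b))
    (rsMap A (LinearMap.lsmul B P b)) (by ext x; exact f.map_smul b x)
    (by ext x; exact g.map_smul b x) x

end Exact

lemma smul_eq_zero_of_mem_map_pow {T : Type} [AddCommGroup T] [Module B T] {n : ℕ} {x : T}
    (h : ∀ a ∈ I ^ n, algebraMap A B a • x = 0) :
    ∀ b ∈ (I.map (algebraMap A B)) ^ n, b • x = 0 := by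
  intro b hb
  have : (I.map (algebraMap A B)) ^ n ≤ LinearMap.ker (LinearMap.toSpanSingleton B T x) := by
    rw [← Ideal.map_pow, Ideal.map_le_iff_le_comap]
    exact h
  exact this hb

lemma LCB.exists_pow_smul_eq_zero {j : ℕ} (x : LCB I B j M) :
    ∃ n, ∀ b ∈ (I.map (algebraMap A B)) ^ n, b • x = 0 := by
  obtain ⟨n, hn⟩ := LC.exists_pow_smul_eq_zero (M := rs A (B := B) M) x
  exact ⟨n, smul_eq_zero_of_mem_map_pow hn⟩

lemma LCB.subsingleton_of_torsion [IsNoetherianRing A] {j : ℕ} (hj : 0 < j)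
    (h : ∀ x : M, ∃ n, ∀ b ∈ (I.map (algebraMap A B)) ^ n, b • x = 0) :
    Subsingleton (LCB I B j M) := by
  refine LC.subsingleton_of_torsion hj (rs A (B := B) M) ?_
  rw [eq_top_iff]
  rintro x -
  obtain ⟨n, hn⟩ := h x
  exact ⟨n, fun a ha => hn (algebraMap A B a)
    (by rw [← Ideal.map_pow]; exact Ideal.mem_map_of_mem _ ha)⟩

variable (I M) in
/-- Evaluation at `1`, as a `B`-linear map. -/
noncomputable def LCB.ev : LCB I B 0 M →ₗ[B] M where
  toFun := LC.ev I (rs A (B := B) M)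
  map_add' := map_add _
  map_smul' _ x := LC.ev_post (M := rs A (B := B) M) _ x

lemma LCB.ev_injective : Function.Injective (LCB.ev I (B := B) M) := LC.ev_injective _

lemma LCB.exists_ev_eq (x : M) (n : ℕ) (hx : ∀ b ∈ (I.map (algebraMap A B)) ^ n, b • x = 0) :
    ∃ t, LCB.ev I (B := B) M t = x :=
  LC.exists_ev_eq (M := rs A (B := B) M) x n fun a ha => hx (algebraMap A B a)
    (by rw [← Ideal.map_pow]; exact Ideal.mem_map_of_mem _ ha)

lemma LCB.subsingleton_zero (h : ∀ x : M, ∀ n, (∀ b ∈ (I.map (algebraMap A B)) ^ n, b • x = 0) →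
    x = 0) : Subsingleton (LCB I B 0 M) := by
  refine subsingleton_of_forall_eq 0 fun t => LCB.ev_injective ?_
  obtain ⟨n, hn⟩ := t.exists_pow_smul_eq_zero
  rw [map_zero]
  exact h _ n fun b hb => by rw [← map_smul, hn b hb, map_zero]

end BaseRing

end

section

section Dual

/-- Every nonzero element of `E` has a nonzero multiple in `S`. -/
def IsEssentialOver {R Q : Type*} [CommRing R] [AddCommGroup Q] [Module R Q]
    (S E : Submodule R Q) : Prop :=
  S ≤ E ∧ ∀ x ∈ E, x ≠ 0 → ∃ b : R, b • x ∈ S ∧ b • x ≠ 0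

lemma exists_maximal_essential {R Q : Type*} [CommRing R] [AddCommGroup Q] [Module R Q]
    (S : Submodule R Q) : ∃ E, Maximal (IsEssentialOver S) E := by
  have : IsEssentialOver S S := ⟨le_rfl, fun x hx h0 => ⟨1, by rwa [one_smul], by rwa [one_smul]⟩⟩
  refine (zorn_le_nonempty₀ {E | IsEssentialOver S E} (fun c hc hchain E hE => ?_) S this).imp
    fun E hE => hE.2
  refine ⟨sSup c, ⟨(hc hE).1.trans (le_sSup hE), fun x hx h0 => ?_⟩, fun z hz => le_sSup hz⟩
  obtain ⟨F, hF, hx⟩ := (Submodule.mem_sSup_of_directed ⟨E, hE⟩ hchain.directedOn).1 hx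
  exact (hc hF).2 x hx h0

lemma exists_maximal_disjoint {R Q : Type*} [CommRing R] [AddCommGroup Q] [Module R Q]
    (E : Submodule R Q) : ∃ C, Maximal (fun C => C ⊓ E = ⊥) C := by
  refine (zorn_le_nonempty₀ {C | C ⊓ E = ⊥} (fun c hc hchain C hC => ?_) ⊥ (by simp)).imp
    fun E hE => hE.2
  refine ⟨sSup c, ?_, fun z hz => le_sSup hz⟩
  refine eq_bot_iff.2 ?_
  rintro x ⟨hx, hxE⟩
  obtain ⟨F, hF, hx⟩ := (Submodule.mem_sSup_of_directed ⟨C, hC⟩ hchain.directedOn).1 hx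
  rw [← show F ⊓ E = ⊥ from hc hF]
  exact ⟨hx, hxE⟩

/-- A maximal essential extension inside an injective module is injective. -/
lemma baer_of_maximal_essential {R Q : Type*} [CommRing R] [AddCommGroup Q] [Module R Q]
    (hQ : Module.Baer R Q) {S E : Submodule R Q} (hE : Maximal (IsEssentialOver S) E) :
    Module.Baer R E := by
  obtain ⟨C, hC⟩ := exists_maximal_disjoint E
  have hCE : C ⊓ E = ⊥ := hC.prop
  obtain ⟨h, hh⟩ := exists_comp_eq_of_ker_le hQ (C.mkQ ∘ₗ E.subtype) E.subtype (by
    intro x hx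
    have hxC : (x : Q) ∈ C := by simpa using hx
    have : (x : Q) ∈ C ⊓ E := ⟨hxC, x.2⟩
    rw [hCE, Submodule.mem_bot] at this
    exact this)
  have hh' : ∀ e (he : e ∈ E), h (C.mkQ e) = e := fun e he => LinearMap.congr_fun hh ⟨e, he⟩
  have hess : ∀ x, x ∉ C → ∃ b : R, ∃ e ∈ E, e ≠ 0 ∧ b • C.mkQ x = C.mkQ e := by
    intro x hx
    have h1 : ¬ ((C ⊔ R ∙ x) ⊓ E = ⊥) := by
      intro h1
      have := hC.le_of_ge h1 le_sup_left
      exact hx (this (Submodule.mem_sup_right (Submodule.mem_span_singleton_self x)))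
    obtain ⟨e, ⟨he, heE⟩, h0⟩ := Submodule.exists_mem_ne_zero_of_ne_bot h1
    obtain ⟨c, hc, y, hy, rfl⟩ := Submodule.mem_sup.1 he
    obtain ⟨b, rfl⟩ := Submodule.mem_span_singleton.1 hy
    refine ⟨b, _, heE, h0, ?_⟩
    rw [map_add, (Submodule.Quotient.mk_eq_zero C).2 hc |> fun h => (h : C.mkQ c = 0), zero_add,
      map_smul]
  have hrange : LinearMap.range (h ∘ₗ C.mkQ) ≤ E := by
    refine hE.le_of_ge ⟨fun s hs => ⟨s, hh' s (hE.prop.1 hs)⟩, ?_⟩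
      fun s hs => ⟨s, hh' s hs⟩
    rintro _ ⟨x, rfl⟩ h0
    have hx : x ∉ C := by
      intro hx
      apply h0
      rw [LinearMap.comp_apply, Submodule.mkQ_apply, (Submodule.Quotient.mk_eq_zero C).2 hx,
        map_zero]
    obtain ⟨b, e, he, he0, hbe⟩ := hess x hx
    obtain ⟨b', hb', hb0⟩ := hE.prop.2 e he he0
    have : (b' * b) • (h ∘ₗ C.mkQ) x = b' • e := by
      rw [mul_smul, LinearMap.comp_apply, ← map_smul h, hbe, hh' e he]
    exact ⟨b' * b, by rwa [this], by rwa [this]⟩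
  intro J f
  obtain ⟨g, hg⟩ := hQ J (E.subtype ∘ₗ f)
  refine ⟨((h ∘ₗ C.mkQ).codRestrict E fun x => hrange ⟨x, rfl⟩) ∘ₗ g, fun x hx => ?_⟩
  apply Subtype.ext
  rw [LinearMap.comp_apply, hg x hx]
  exact hh' _ (f ⟨x, hx⟩).2

variable (B : Type) [CommRing B] [IsLocalRing B]

/-- An injective cogenerator into which the residue field has few maps. -/
structure IsDualizing (J : Type) [AddCommGroup J] [Module B J] : Prop where
  baer : Module.Baer B J
  exists_ne_zero : ∀ {X : Type} [AddCommGroup X] [Module B X] (x : X), x ≠ 0 →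
    ∃ f : X →ₗ[B] J, f x ≠ 0
  finite : Module.Finite B (IsLocalRing.ResidueField B →ₗ[B] J)

lemma exists_isDualizing [IsNoetherianRing B] :
    ∃ (J : Type) (_ : AddCommGroup J) (_ : Module B J), IsDualizing B J := by
  let k := IsLocalRing.ResidueField B
  let Q : ModuleCat.{0} B := Injective.under (ModuleCat.of B k)
  have hQ : Module.Injective B Q :=
    (Module.injective_iff_injective_object B Q).2
      (inferInstanceAs (Injective (Injective.under (ModuleCat.of B k))))
  let ι : k →ₗ[B] Q := (Injective.ι (ModuleCat.of B k)).hom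
  have hι : Function.Injective ι := (ModuleCat.mono_iff_injective _).1
    (inferInstance : Mono (Injective.ι (ModuleCat.of B k)))
  obtain ⟨E, hE⟩ := exists_maximal_essential (LinearMap.range ι)
  have hB := baer_of_maximal_essential (Module.Baer.iff_injective.2 hQ) hE
  refine ⟨E, inferInstance, inferInstance, hB, fun {X} _ _ x hx => ?_, ?_⟩
  · let φ : B →ₗ[B] E := LinearMap.toSpanSingleton B E ⟨ι 1, hE.prop.1 ⟨1, rfl⟩⟩
    have hφ : LinearMap.ker (LinearMap.toSpanSingleton B X x) ≤ LinearMap.ker φ := by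
      intro b hb
      have hbm : b ∈ IsLocalRing.maximalIdeal B := by
        rw [IsLocalRing.mem_maximalIdeal, mem_nonunits_iff]
        intro hu
        apply hx
        have : b • x = 0 := hb
        exact hu.smul_eq_zero.1 this
      apply Subtype.ext
      change b • ι 1 = 0
      rw [← map_smul, Algebra.smul_def, mul_one]
      rw [show algebraMap B k b = 0 from (IsLocalRing.residue_eq_zero_iff b).2 hbm, map_zero]
    obtain ⟨g, hg⟩ := exists_comp_eq_of_ker_le hB _ φ hφ
    refine ⟨g, fun h0 => ?_⟩
    have h1 := LinearMap.congr_fun hg 1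
    simp only [LinearMap.comp_apply, LinearMap.toSpanSingleton_apply, one_smul, h0, φ] at h1
    have h2 : ι 1 = 0 := (congrArg Subtype.val h1).symm
    exact one_ne_zero (hι (h2.trans (map_zero ι).symm))
  · let ev : (k →ₗ[B] E) →ₗ[B] Q := E.subtype ∘ₗ LinearMap.applyₗ (1 : k)
    have hev : ∀ f, ev f ∈ LinearMap.range ι := by
      intro f
      by_cases h0 : ev f = 0
      · rw [h0]; exact zero_mem _
      obtain ⟨b, hb, hb0⟩ := hE.prop.2 (ev f) (f 1).2 h0
      have hu : IsUnit b := by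
        by_contra hu
        apply hb0
        rw [← map_smul]
        have : b • f = 0 := by
          refine LinearMap.ext fun z => ?_
          have hz : b • z = 0 := by
            rw [Algebra.smul_def,
              show algebraMap B k b = 0 from (IsLocalRing.residue_eq_zero_iff b).2 hu, zero_mul]
          rw [LinearMap.smul_apply, ← map_smul, hz, map_zero, LinearMap.zero_apply]
        rw [this, map_zero]
      exact (Submodule.smul_mem_iff_of_isUnit _ hu).1 hb
    have : Module.Finite B (LinearMap.range ι) := inferInstance
    refine Module.Finite.of_injective (ev.codRestrict _ hev) fun f g hfg => ?_
    have h1 : f 1 = g 1 := Subtype.ext (by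
      have := congrArg Subtype.val hfg
      exact this)
    refine LinearMap.ext fun z => ?_
    obtain ⟨c, rfl⟩ := IsLocalRing.residue_surjective z
    have hc : IsLocalRing.residue B c = c • (1 : k) := by
      rw [Algebra.smul_def, mul_one]; rfl
    rw [hc, map_smul, map_smul, h1]

end Dual

end

section

section Complete

lemma isPrecomplete_of_le_of_isHausdorff {B : Type*} [CommRing B] {𝔪 : Ideal B}
    [IsPrecomplete 𝔪 B] {J : Ideal B} (hJ : J ≤ 𝔪) (hcl : ∀ n, IsHausdorff 𝔪 (B ⧸ J ^ n)) :
    IsPrecomplete J B := by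
  refine ⟨fun f hf => ?_⟩
  have hf' : ∀ {m n}, m ≤ n → f m - f n ∈ J ^ m := fun {m n} h => by
    have := SModEq.sub_mem.1 (hf h)
    simpa using this
  obtain ⟨L, hL⟩ := IsPrecomplete.prec (I := 𝔪) (M := B) inferInstance
    (f := f) (fun {m n} h => by
      rw [SModEq.sub_mem]
      simpa using Ideal.pow_right_mono hJ m (hf' h))
  refine ⟨L, fun n => ?_⟩
  rw [SModEq.sub_mem, smul_eq_mul, Ideal.mul_top, ← Ideal.Quotient.eq_zero_iff_mem]
  refine IsHausdorff.haus (hcl n) _ fun k => ?_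
  rw [SModEq.zero]
  have h1 : f (n + k) - L ∈ 𝔪 ^ k := by
    have := SModEq.sub_mem.1 (hL (n + k))
    simp only [smul_eq_mul, Ideal.mul_top] at this
    exact Ideal.pow_le_pow_right (by lia) this
  have h2 : Ideal.Quotient.mk (J ^ n) (f n - L) = (f (n + k) - L) • (1 : B ⧸ J ^ n) := by
    rw [Algebra.smul_def, mul_one, Ideal.Quotient.algebraMap_eq, Ideal.Quotient.mk_eq_mk_iff_sub_mem]
    simpa using hf' (show n ≤ n + k by lia)
  rw [h2]
  exact Submodule.smul_mem_smul h1 trivial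

lemma isPrecomplete_of_le {B : Type*} [CommRing B] [IsNoetherianRing B] [IsLocalRing B]
    [IsAdicComplete (IsLocalRing.maximalIdeal B) B] {J : Ideal B}
    (hJ : J ≤ IsLocalRing.maximalIdeal B) : IsPrecomplete J B :=
  isPrecomplete_of_le_of_isHausdorff hJ fun _ => inferInstance

lemma mem_smul_top_pi_iff {B : Type*} [CommRing B] {J : Ideal B} {r : ℕ} (x : Fin r → B) :
    x ∈ (J • ⊤ : Submodule B (Fin r → B)) ↔ ∀ i, x i ∈ J := by
  constructor
  · intro hx i
    induction hx using Submodule.smul_induction_on' with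
    | smul a ha m hm => exact J.mul_mem_right _ ha
    | add y _ z _ hy hz => exact J.add_mem hy hz
  · intro hx
    rw [pi_eq_sum_univ' x]
    exact Submodule.sum_mem _ fun i _ => Submodule.smul_mem_smul (hx i) trivial

lemma isPrecomplete_pi {B : Type*} [CommRing B] {J : Ideal B} [IsPrecomplete J B] (r : ℕ) :
    IsPrecomplete J (Fin r → B) := by
  refine ⟨fun f hf => ?_⟩
  have key : ∀ i, ∃ L, ∀ n, f n i ≡ L [SMOD (J ^ n • ⊤ : Submodule B B)] := fun i =>
    IsPrecomplete.prec (I := J) (M := B) inferInstance (f := fun n => f n i) (fun {m n} h => by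
      have := (mem_smul_top_pi_iff _).1 (SModEq.sub_mem.1 (hf h)) i
      rw [SModEq.sub_mem]
      simpa using this)
  choose L hL using key
  refine ⟨L, fun n => ?_⟩
  rw [SModEq.sub_mem, mem_smul_top_pi_iff]
  intro i
  have := SModEq.sub_mem.1 (hL i n)
  simpa using this

/-- A module which is separated for a complete principal topology and finite modulo the
generator is finite. -/
lemma finite_of_finite_quotient {B : Type*} [CommRing B] {y : B}
    [IsPrecomplete (Ideal.span {y}) B] {N : Type*} [AddCommGroup N] [Module B N]
    (hN : ∀ x : N, (∀ n, ∃ z, x = y ^ n • z) → x = 0)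
    [Module.Finite B (N ⧸ LinearMap.range (LinearMap.lsmul B N y))] : Module.Finite B N := by
  have hspan : ∀ n, ((Ideal.span {y}) ^ n • ⊤ : Submodule B N) =
      LinearMap.range (LinearMap.lsmul B N (y ^ n)) := by
    intro n
    rw [Ideal.span_singleton_pow, Submodule.ideal_span_singleton_smul]
    ext x
    simp [Submodule.mem_smul_pointwise_iff_exists]
  have : IsHausdorff (Ideal.span {y}) N := by
    refine ⟨fun x hx => hN x fun n => ?_⟩
    have := hx n
    rw [SModEq.zero, hspan] at this
    obtain ⟨z, rfl⟩ := this
    exact ⟨z, rfl⟩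
  obtain ⟨r, φ, hφ⟩ := Module.Finite.exists_fin' B (N ⧸ LinearMap.range (LinearMap.lsmul B N y))
  obtain ⟨ψ, hψ⟩ := Module.projective_lifting_property
    (LinearMap.range (LinearMap.lsmul B N y)).mkQ φ (Submodule.mkQ_surjective _)
  have := isPrecomplete_pi (J := Ideal.span {y}) r
  have h1 := hspan 1
  rw [pow_one, pow_one] at h1
  refine Module.Finite.of_surjective ψ (surjective_of_mkQ_comp_surjective (I := Ideal.span {y}) ?_)
  rw [h1, hψ]
  exact hφ

end Complete

end

section

section Dimension

variable {B : Type*} [CommRing B]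

lemma ringKrullDim_quotient_succ_le {q 𝔟 : Ideal B} [q.IsPrime] (h : q < 𝔟) :
    ringKrullDim (B ⧸ 𝔟) + 1 ≤ ringKrullDim (B ⧸ q) := by
  obtain ⟨x, hx, hxq⟩ := Set.exists_of_ssubset h
  refine ringKrullDim_succ_le_of_surjective (Ideal.Quotient.factor h.le)
    (Ideal.Quotient.factor_surjective h.le) (r := Ideal.Quotient.mk q x) ?_ ?_
  · exact mem_nonZeroDivisors_of_ne_zero fun h0 => hxq (Ideal.Quotient.eq_zero_iff_mem.1 h0)
  · rw [Ideal.Quotient.factor_mk]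
    exact Ideal.Quotient.eq_zero_iff_mem.2 hx

lemma ringKrullDim_quotient_le_of_lt {q 𝔟 : Ideal B} [q.IsPrime] (h : q < 𝔟) {n : ℕ}
    (hq : ringKrullDim (B ⧸ q) ≤ (n + 1 : ℕ)) : ringKrullDim (B ⧸ 𝔟) ≤ n := by
  have := (ringKrullDim_quotient_succ_le h).trans hq
  generalize ringKrullDim (B ⧸ 𝔟) = e at *
  induction e with
  | bot => simp
  | coe e =>
    induction e with
    | top => exact absurd (top_le_iff.1 (WithBot.coe_le_coe.1 this)) (ENat.natCast_ne_top _)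
    | coe e => norm_cast at *; omega

lemma ringKrullDim_quotient_antitone {𝔞 𝔟 : Ideal B} (h : 𝔞 ≤ 𝔟) :
    ringKrullDim (B ⧸ 𝔟) ≤ ringKrullDim (B ⧸ 𝔞) :=
  ringKrullDim_le_of_surjective _ (Ideal.Quotient.factor_surjective h)

lemma exists_prime_le_ringKrullDim_quotient {𝔟 : Ideal B} {n : ℕ}
    (h : (n : WithBot ℕ∞) ≤ ringKrullDim (B ⧸ 𝔟)) :
    ∃ p : Ideal B, p.IsPrime ∧ 𝔟 ≤ p ∧ (n : WithBot ℕ∞) ≤ ringKrullDim (B ⧸ p) := by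
  rw [ringKrullDim_quotient, Order.le_krullDim_iff] at h
  obtain ⟨l, hl⟩ := h
  refine ⟨l.head.1.asIdeal, l.head.1.2, l.head.2, ?_⟩
  rw [ringKrullDim_quotient, Order.le_krullDim_iff]
  refine ⟨⟨l.length, fun i => ⟨(l i).1, ?_⟩, fun i => ?_⟩, hl⟩
  · exact (LTSeries.monotone l (Fin.zero_le i) : l.head ≤ l i)
  · exact l.step i

variable [IsLocalRing B]

lemma le_ringKrullDim_quotient_sup [IsNoetherianRing B] {q : Ideal B} [hq : q.IsPrime] {x : B}
    (hx : x ∈ IsLocalRing.maximalIdeal B) (hxq : x ∉ q) {n : ℕ}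
    (h : ((n + 1 : ℕ) : WithBot ℕ∞) ≤ ringKrullDim (B ⧸ q)) :
    (n : WithBot ℕ∞) ≤ ringKrullDim (B ⧸ q ⊔ Ideal.span {x}) := by
  have : IsLocalRing (B ⧸ q) :=
    IsLocalRing.of_surjective' _ (Ideal.Quotient.mk_surjective (I := q))
  have h1 : Ideal.Quotient.mk q x ∈ IsLocalRing.maximalIdeal (B ⧸ q) := by
    rw [IsLocalRing.mem_maximalIdeal] at hx ⊢
    intro hu
    obtain ⟨y, hy⟩ := hu.exists_right_inv
    obtain ⟨y, rfl⟩ := Ideal.Quotient.mk_surjective y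
    rw [← map_mul, ← map_one (Ideal.Quotient.mk q), Ideal.Quotient.eq] at hy
    have h2 : x * y - 1 ∈ IsLocalRing.maximalIdeal B := IsLocalRing.le_maximalIdeal hq.ne_top hy
    have h3 : x * y ∈ IsLocalRing.maximalIdeal B := Ideal.mul_mem_right _ _ hx
    have := Ideal.sub_mem _ h3 h2
    rw [sub_sub_cancel] at this
    exact (Ideal.ne_top_iff_one _).1 (IsLocalRing.maximalIdeal.isMaximal B).ne_top this
  have h2 := ringKrullDim_quotient_span_singleton_succ_eq_ringKrullDim_of_mem_nonZeroDivisors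
    (mem_nonZeroDivisors_of_ne_zero
      fun h0 => hxq (Ideal.Quotient.eq_zero_iff_mem.1 h0)) h1
  have h3 : ringKrullDim ((B ⧸ q) ⧸ Ideal.span {Ideal.Quotient.mk q x}) ≤
      ringKrullDim (B ⧸ q ⊔ Ideal.span {x}) := by
    refine ringKrullDim_le_of_surjective (Ideal.Quotient.lift (q ⊔ Ideal.span {x})
      ((Ideal.Quotient.mk (Ideal.span {Ideal.Quotient.mk q x})).comp (Ideal.Quotient.mk q)) ?_) ?_
    · intro a ha
      have : q ⊔ Ideal.span {x} ≤ RingHom.ker ((Ideal.Quotient.mk (Ideal.span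
          {Ideal.Quotient.mk q x})).comp (Ideal.Quotient.mk q)) := by
        refine sup_le (fun b hb => ?_) ((Ideal.span_singleton_le_iff_mem _).2 ?_)
        · rw [RingHom.mem_ker, RingHom.comp_apply, Ideal.Quotient.eq_zero_iff_mem.2 hb, map_zero]
        · rw [RingHom.mem_ker, RingHom.comp_apply, Ideal.Quotient.eq_zero_iff_mem]
          exact Ideal.mem_span_singleton_self _
      exact this ha
    · exact Ideal.Quotient.lift_surjective_of_surjective _ _
        (Ideal.Quotient.mk_surjective.comp Ideal.Quotient.mk_surjective)
  refine le_trans ?_ h3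
  rw [← h2] at h
  generalize ringKrullDim ((B ⧸ q) ⧸ Ideal.span {Ideal.Quotient.mk q x}) = e at *
  induction e with
  | bot => simp at h
  | coe e =>
    induction e with
    | top => exact WithBot.coe_le_coe.2 le_top
    | coe e => norm_cast at *; omega

lemma eq_maximalIdeal_of_ringKrullDim_le_zero {q : Ideal B} [hq : q.IsPrime]
    (h : ringKrullDim (B ⧸ q) ≤ 0) : q = IsLocalRing.maximalIdeal B := by
  by_contra hne
  have hlt := lt_of_le_of_ne (IsLocalRing.le_maximalIdeal hq.ne_top) hne
  have h1 := (ringKrullDim_quotient_succ_le hlt).trans h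
  have h2 := ringKrullDim_nonneg_of_nontrivial (R := B ⧸ IsLocalRing.maximalIdeal B)
  generalize ringKrullDim (B ⧸ IsLocalRing.maximalIdeal B) = e at *
  induction e with
  | bot => simp at h2
  | coe e =>
    induction e with
    | top => exact absurd (top_le_iff.1 (WithBot.coe_le_coe.1 h1)) (by simp)
    | coe e => norm_cast at *

end Dimension

section Filtration

variable {B : Type} [CommRing B] [IsNoetherianRing B]

/-- Dévissage: a property of finite modules stable under extensions holds for all finite modules
killed by `𝔞` if it holds for the modules `B ⧸ q` with `q` a prime containing `𝔞`. -/
lemma devissage (𝔞 : Ideal B) (Φ : (N : Type) → [AddCommGroup N] → [Module B N] → Prop)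
    (h0 : ∀ (N : Type) [AddCommGroup N] [Module B N] [Subsingleton N], Φ N)
    (hcongr : ∀ (N N' : Type) [AddCommGroup N] [Module B N] [AddCommGroup N'] [Module B N'],
      (N ≃ₗ[B] N') → Φ N' → Φ N)
    (hprime : ∀ (q : Ideal B) [q.IsPrime], 𝔞 ≤ q → Φ (B ⧸ q))
    (hexact : ∀ (N₁ N₂ N₃ : Type) [AddCommGroup N₁] [Module B N₁] [AddCommGroup N₂] [Module B N₂]
      [AddCommGroup N₃] [Module B N₃] (f : N₁ →ₗ[B] N₂) (g : N₂ →ₗ[B] N₃),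
      Function.Injective f → Function.Surjective g → Function.Exact f g → Φ N₁ → Φ N₃ → Φ N₂)
    (N : Type) [AddCommGroup N] [Module B N] [Module.Finite B N]
    (hN : ∀ a ∈ 𝔞, ∀ x : N, a • x = 0) : Φ N := by
  revert hN
  refine IsNoetherianRing.induction_on_isQuotientEquivQuotientPrime (A := B) (M := N)
    inferInstance (motive := fun N _ _ _ => (∀ a ∈ 𝔞, ∀ x : N, a • x = 0) → Φ N) ?_ ?_ ?_
  · intro N _ _ _ _ _
    exact h0 N
  · intro N _ _ _ p e hN
    have := p.2
    refine hcongr _ _ e (hprime p.1 fun a ha => ?_)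
    have h1 := hN a ha (e.symm 1)
    rw [← map_smul, LinearEquiv.map_eq_zero_iff] at h1
    rw [← Ideal.Quotient.eq_zero_iff_mem, ← mul_one (Ideal.Quotient.mk p.1 a)]
    exact h1
  · intro N₁ _ _ _ N₂ _ _ _ N₃ _ _ _ f g hf hg hfg h₁ h₃ hN
    refine hexact N₁ N₂ N₃ f g hf hg hfg (h₁ fun a ha x => hf ?_) (h₃ fun a ha x => ?_)
    · rw [map_smul, hN a ha, map_zero]
    · obtain ⟨x, rfl⟩ := hg x
      rw [← map_smul, hN a ha, map_zero]

end Filtration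

end

section

section MainClaims

variable {A : Type} [CommRing A] {I : Ideal A} {B : Type} [CommRing B] [Algebra A B]

section General

variable {N N' : Type} [AddCommGroup N] [Module B N] [AddCommGroup N'] [Module B N']

lemma LCB.subsingleton_of_exact {M P : Type} [AddCommGroup M] [Module B M] [AddCommGroup P]
    [Module B P] {f : M →ₗ[B] N} {g : N →ₗ[B] P} (hf : Function.Injective f)
    (hg : Function.Surjective g) (h : Function.Exact f g) (j : ℕ) [Subsingleton (LCB I B j M)]
    [Subsingleton (LCB I B j P)] : Subsingleton (LCB I B j N) := by
  refine subsingleton_of_forall_eq 0 fun x => ?_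
  obtain ⟨y, rfl⟩ := (LCB.map_exact (I := I) hf hg h j x).1 (Subsingleton.elim _ _)
  rw [Subsingleton.elim y 0, map_zero]

lemma LCB.map_surjective {g : N →ₗ[B] N'} (hg : Function.Surjective g) (j : ℕ)
    [Subsingleton (LCB I B (j + 1) (LinearMap.ker g))] :
    Function.Surjective (LCB.map I j g) := by
  obtain ⟨δ, h₁, -⟩ := LCB.exists_connecting (I := I) (LinearMap.ker g).injective_subtype hg
    (LinearMap.exact_subtype_ker_map g) j
  exact fun x => (h₁ x).1 (Subsingleton.elim _ _)

lemma LCB.subsingleton_of_subsingleton (j : ℕ) [Subsingleton N] :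
    Subsingleton (LCB I B j N) := by
  refine subsingleton_of_forall_eq 0 fun x => ?_
  have h : LCB.map I j (LinearMap.id : N →ₗ[B] N) x = LCB.map I j (0 : N →ₗ[B] N) x := by
    rw [Subsingleton.elim (LinearMap.id : N →ₗ[B] N) 0]
  rw [LCB.map_id] at h
  exact h.trans (LCB.mapAdd_zero x)

lemma LCB.smul_eq_zero (j : ℕ) {s : B} (hs : ∀ x : N, s • x = 0) (x : LCB I B j N) :
    s • x = 0 := by
  have : LinearMap.lsmul B N s = 0 := LinearMap.ext hs
  rw [← LCB.map_lsmul, this]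
  exact LCB.mapAdd_zero x

/-- The long exact sequence attached to multiplication by a nonzerodivisor. -/
lemma LCB.exists_bockstein {y : B} (hy : Function.Injective (LinearMap.lsmul B N y)) (j : ℕ) :
    ∃ δ : LCB I B j (N ⧸ LinearMap.range (LinearMap.lsmul B N y)) →ₗ[B] LCB I B (j + 1) N,
      Function.Exact (LCB.map I j (LinearMap.range (LinearMap.lsmul B N y)).mkQ) δ ∧
      Function.Exact δ (LinearMap.lsmul B (LCB I B (j + 1) N) y) := by
  obtain ⟨δ, h₁, h₂⟩ := LCB.exists_connecting (I := I) hy (Submodule.mkQ_surjective _)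
    (LinearMap.exact_map_mkQ_range (LinearMap.lsmul B N y)) j
  exact ⟨δ, h₁, h₂⟩

lemma LCB.exists_pow_smul_eq_zero_of_mem {j : ℕ} {y : B} (hy : y ∈ I.map (algebraMap A B))
    (x : LCB I B j N) : ∃ n, y ^ n • x = 0 := by
  obtain ⟨n, hn⟩ := x.exists_pow_smul_eq_zero
  exact ⟨n, hn _ (Ideal.pow_mem_pow hy n)⟩

lemma LCB.subsingleton_of_le_prime [IsNoetherianRing A] {q : Ideal B}
    (h : I.map (algebraMap A B) ≤ q) {j : ℕ} (hj : 0 < j) : Subsingleton (LCB I B j (B ⧸ q)) := by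
  refine LCB.subsingleton_of_torsion hj fun x => ⟨1, fun b hb => ?_⟩
  rw [pow_one] at hb
  rw [Algebra.smul_def, Ideal.Quotient.algebraMap_eq, Ideal.Quotient.eq_zero_iff_mem.2 (h hb),
    zero_mul]

lemma lsmul_quotient_injective {q : Ideal B} [q.IsPrime] {y : B} (hy : y ∉ q) :
    Function.Injective (LinearMap.lsmul B (B ⧸ q) y) := by
  refine (injective_iff_map_eq_zero _).2 fun x hx => ?_
  rw [LinearMap.lsmul_apply, Algebra.smul_def, Ideal.Quotient.algebraMap_eq] at hx
  exact (mul_eq_zero.1 hx).resolve_left fun h => hy (Ideal.Quotient.eq_zero_iff_mem.1 h)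

lemma smul_quotient_range_eq_zero {q : Ideal B} {y a : B} (ha : a ∈ q ⊔ Ideal.span {y})
    (x : (B ⧸ q) ⧸ LinearMap.range (LinearMap.lsmul B (B ⧸ q) y)) : a • x = 0 := by
  have : q ⊔ Ideal.span {y} ≤ LinearMap.ker (LinearMap.toSpanSingleton B _ x) := by
    obtain ⟨x, rfl⟩ := Submodule.mkQ_surjective _ x
    refine sup_le (fun b hb => ?_) ((Ideal.span_singleton_le_iff_mem _).2 ?_)
    · rw [LinearMap.mem_ker, LinearMap.toSpanSingleton_apply, ← map_smul, Algebra.smul_def,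
        Ideal.Quotient.algebraMap_eq, Ideal.Quotient.eq_zero_iff_mem.2 hb, zero_mul, map_zero]
    · rw [LinearMap.mem_ker, LinearMap.toSpanSingleton_apply, ← map_smul, Submodule.mkQ_apply,
        Submodule.Quotient.mk_eq_zero]
      exact ⟨x, rfl⟩
  exact this ha

lemma LCB.subsingleton_zero_of_not_le {q : Ideal B} [q.IsPrime]
    (h : ¬ I.map (algebraMap A B) ≤ q) : Subsingleton (LCB I B 0 (B ⧸ q)) := by
  obtain ⟨y, hy, hyq⟩ := SetLike.not_le_iff_exists.1 h
  refine LCB.subsingleton_zero fun x n hx => ?_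
  have h1 := hx _ (Ideal.pow_mem_pow hy n)
  exact (injective_iff_map_eq_zero _).1
    (lsmul_quotient_injective fun h => hyq (Ideal.IsPrime.mem_of_pow_mem ‹_› n h)) x h1

end General

lemma lt_sup_span {q : Ideal B} {y : B} (hy : y ∉ q) : q < q ⊔ Ideal.span {y} :=
  lt_of_le_of_ne le_sup_left fun h =>
    hy (h ▸ (le_sup_right (a := q) : Ideal.span {y} ≤ _) (Ideal.mem_span_singleton_self y))

lemma LCB.subsingleton_of_forall_prime [IsNoetherianRing B] {j : ℕ} (𝔞 : Ideal B)
    (h : ∀ (q : Ideal B) [q.IsPrime], 𝔞 ≤ q → Subsingleton (LCB I B j (B ⧸ q)))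
    (N : Type) [AddCommGroup N] [Module B N] [Module.Finite B N]
    (hN : ∀ a ∈ 𝔞, ∀ x : N, a • x = 0) : Subsingleton (LCB I B j N) := by
  refine devissage 𝔞 (fun N _ _ => Subsingleton (LCB I B j N)) ?_ ?_ ?_ ?_ N hN
  · intro N _ _ _
    exact LCB.subsingleton_of_subsingleton j
  · intro N N' _ _ _ _ e h
    exact (LCB.congr I j e).injective.subsingleton
  · intro q _ hq
    exact h q hq
  · intro N₁ N₂ N₃ _ _ _ _ _ _ f g hf hg hfg h₁ h₃
    exact LCB.subsingleton_of_exact hf hg hfg j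

variable [IsNoetherianRing A] [IsNoetherianRing B]

/-- Vanishing above the dimension. -/
lemma LCB.subsingleton_of_dim_lt : ∀ (j : ℕ) (q : Ideal B) [q.IsPrime],
    ringKrullDim (B ⧸ q) < j → Subsingleton (LCB I B j (B ⧸ q))
  | 0, q, _, h => absurd h (not_lt.2 (ringKrullDim_nonneg_of_nontrivial (R := B ⧸ q)))
  | j + 1, q, hq, h => by
    by_cases hle : I.map (algebraMap A B) ≤ q
    · exact LCB.subsingleton_of_le_prime hle j.succ_pos
    obtain ⟨y, hy, hyq⟩ := SetLike.not_le_iff_exists.1 hle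
    obtain ⟨δ, -, hδ⟩ := LCB.exists_bockstein (I := I) (lsmul_quotient_injective hyq) j
    have : Subsingleton
        (LCB I B j ((B ⧸ q) ⧸ LinearMap.range (LinearMap.lsmul B (B ⧸ q) y))) := by
      refine LCB.subsingleton_of_forall_prime (q ⊔ Ideal.span {y}) (fun q' _ hq' => ?_) _
        fun a ha x => smul_quotient_range_eq_zero ha x
      refine LCB.subsingleton_of_dim_lt j q' ?_
      have h1 := (ringKrullDim_quotient_succ_le ((lt_sup_span hyq).trans_le hq')).trans_lt h
      generalize ringKrullDim (B ⧸ q') = e at *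
      induction e with
      | bot => exact WithBot.bot_lt_coe _
      | coe e =>
        induction e with
        | top => exact absurd h1 (not_lt.2 (le_top.trans_eq rfl))
        | coe e => norm_cast at *; omega
    have hinj : ∀ x : LCB I B (j + 1) (B ⧸ q), y • x = 0 → x = 0 := by
      intro x hx
      obtain ⟨z, rfl⟩ := (hδ x).1 hx
      rw [Subsingleton.elim z 0, map_zero]
    refine subsingleton_of_forall_eq 0 fun x => ?_
    obtain ⟨n, hn⟩ := LCB.exists_pow_smul_eq_zero_of_mem hy x
    induction n with
    | zero => simpa using hn
    | succ n ih => exact ih (hinj _ (by rw [smul_smul, ← pow_succ']; exact hn))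

lemma LCB.subsingleton_of_dim_lt' {j : ℕ} {𝔞 : Ideal B} (h : ringKrullDim (B ⧸ 𝔞) < j)
    (N : Type) [AddCommGroup N] [Module B N] [Module.Finite B N]
    (hN : ∀ a ∈ 𝔞, ∀ x : N, a • x = 0) : Subsingleton (LCB I B j N) :=
  LCB.subsingleton_of_forall_prime 𝔞
    (fun q _ hq => LCB.subsingleton_of_dim_lt j q
      ((ringKrullDim_quotient_antitone hq).trans_lt h)) N hN

lemma LCB.smul_surjective {j : ℕ} {q : Ideal B} [q.IsPrime] (hq : ringKrullDim (B ⧸ q) ≤ j + 1)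
    {a : B} (ha : a ∉ q) (x : LCB I B (j + 1) (B ⧸ q)) :
    ∃ z, x = a • z := by
  have hex := LCB.map_exact (I := I) (lsmul_quotient_injective ha) (Submodule.mkQ_surjective _)
    (LinearMap.exact_map_mkQ_range (LinearMap.lsmul B (B ⧸ q) a)) (j + 1)
  have : Subsingleton
      (LCB I B (j + 1) ((B ⧸ q) ⧸ LinearMap.range (LinearMap.lsmul B (B ⧸ q) a))) := by
    refine LCB.subsingleton_of_dim_lt' (𝔞 := q ⊔ Ideal.span {a}) ?_ _
        fun a ha x => smul_quotient_range_eq_zero ha x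
    refine (ringKrullDim_quotient_le_of_lt (lt_sup_span ha) (n := j) (by exact_mod_cast hq)).trans_lt ?_
    exact_mod_cast Nat.lt_succ_self j
  obtain ⟨z, hz⟩ := (hex x).1 (Subsingleton.elim _ _)
  exact ⟨z, hz.symm⟩

end MainClaims

end

section

section Duality

lemma finite_dual_of_subsingleton {B : Type} [CommRing B] {J : Type} [AddCommGroup J]
    [Module B J] {X : Type} [AddCommGroup X] [Module B X] [Subsingleton X] :
    Module.Finite B (X →ₗ[B] J) := by
  have : Subsingleton (X →ₗ[B] J) := ⟨fun f g => LinearMap.ext fun x => by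
    rw [Subsingleton.elim x 0, map_zero, map_zero]⟩
  infer_instance

variable {B : Type} [CommRing B] [IsLocalRing B] {J : Type} [AddCommGroup J] [Module B J]

lemma IsDualizing.subsingleton (hJ : IsDualizing B J) {X : Type} [AddCommGroup X] [Module B X]
    (h : ∀ f : X →ₗ[B] J, f = 0) : Subsingleton X := by
  refine subsingleton_of_forall_eq 0 fun x => ?_
  by_contra hx
  obtain ⟨f, hf⟩ := hJ.exists_ne_zero x hx
  exact hf (by rw [h f, LinearMap.zero_apply])

lemma IsDualizing.exact (hJ : IsDualizing B J) {X Y Z : Type} [AddCommGroup X] [Module B X]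
    [AddCommGroup Y] [Module B Y] [AddCommGroup Z] [Module B Z] {f : X →ₗ[B] Y} {g : Y →ₗ[B] Z}
    (h : Function.Exact f g) : Function.Exact (LinearMap.lcomp B J g) (LinearMap.lcomp B J f) := by
  intro φ
  constructor
  · intro hφ
    obtain ⟨ψ, hψ⟩ := exists_comp_eq_of_ker_le hJ.baer g φ fun y hy => by
      obtain ⟨x, rfl⟩ := (h y).1 hy
      exact LinearMap.congr_fun hφ x
    exact ⟨ψ, hψ⟩
  · rintro ⟨ψ, rfl⟩
    ext x
    simp [h.apply_apply_eq_zero x]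

lemma IsDualizing.finite_of_exact [IsNoetherianRing B] (hJ : IsDualizing B J)
    {X Y Z : Type} [AddCommGroup X] [Module B X]
    [AddCommGroup Y] [Module B Y] [AddCommGroup Z] [Module B Z] {f : X →ₗ[B] Y} {g : Y →ₗ[B] Z}
    (h : Function.Exact f g) [Module.Finite B (X →ₗ[B] J)] [Module.Finite B (Z →ₗ[B] J)] :
    Module.Finite B (Y →ₗ[B] J) := by
  have h1 := isNoetherian_of_range_eq_ker _ _ (hJ.exact h).linearMap_ker_eq.symm
  infer_instance

end Duality

section Main

variable {A : Type} [CommRing A] [IsNoetherianRing A] {I : Ideal A} {B : Type} [CommRing B]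
  [Algebra A B] [IsNoetherianRing B] [IsLocalRing B]
  {J : Type} [AddCommGroup J] [Module B J]

open IsLocalRing

/-- Finiteness of the dual of local cohomology. -/
lemma LCB.finite_dual [IsAdicComplete (maximalIdeal B) B] (hJ : IsDualizing B J)
    (hI : I.map (algebraMap A B) ≤ maximalIdeal B) :
    ∀ (j : ℕ) (q : Ideal B) [q.IsPrime], (ringKrullDim (B ⧸ q) ≤ j ∨
      maximalIdeal B ≤ (I.map (algebraMap A B) ⊔ q).radical) →
      Module.Finite B (LCB I B j (B ⧸ q) →ₗ[B] J)
  | 0, q, hq, h => by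
    by_cases hle : I.map (algebraMap A B) ≤ q
    · obtain rfl : q = maximalIdeal B := by
        rcases h with h | h
        · exact eq_maximalIdeal_of_ringKrullDim_le_zero h
        · rw [sup_eq_right.2 hle, hq.radical] at h
          exact le_antisymm (le_maximalIdeal hq.ne_top) h
      have hfin : Module.Finite B ((B ⧸ maximalIdeal B) →ₗ[B] J) := hJ.finite
      refine Module.Finite.of_surjective
        (LinearMap.lcomp B J (LCB.ev I (B := B) (B ⧸ maximalIdeal B))) fun φ => ?_
      obtain ⟨ψ, hψ⟩ := exists_comp_eq_of_ker_le hJ.baer (LCB.ev I (B ⧸ maximalIdeal B)) φ (by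
        rw [LinearMap.ker_eq_bot.2 LCB.ev_injective]; exact bot_le)
      exact ⟨ψ, hψ⟩
    · have := LCB.subsingleton_zero_of_not_le hle
      exact finite_dual_of_subsingleton
  | j + 1, q, hq, h => by
    by_cases hle : I.map (algebraMap A B) ≤ q
    · have := LCB.subsingleton_of_le_prime hle j.succ_pos
      exact finite_dual_of_subsingleton
    obtain ⟨y, hy, hyq⟩ := SetLike.not_le_iff_exists.1 hle
    obtain ⟨δ, -, hδ⟩ := LCB.exists_bockstein (I := I) (lsmul_quotient_injective hyq) j
    have hfin : Module.Finite B
        (LCB I B j ((B ⧸ q) ⧸ LinearMap.range (LinearMap.lsmul B (B ⧸ q) y)) →ₗ[B] J) := by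
      refine devissage (q ⊔ Ideal.span {y})
        (fun N _ _ => Module.Finite B (LCB I B j N →ₗ[B] J)) ?_ ?_ ?_ ?_ _
        fun a ha x => smul_quotient_range_eq_zero ha x
      · intro N _ _ _
        have := LCB.subsingleton_of_subsingleton (I := I) (B := B) (N := N) j
        exact finite_dual_of_subsingleton
      · intro N N' _ _ _ _ e h
        exact Module.Finite.of_surjective (LinearMap.lcomp B J (LCB.congr I j e).toLinearMap)
          fun φ => ⟨φ ∘ₗ (LCB.congr I j e).symm.toLinearMap, by ext; simp⟩
      · intro q' _ hq'
        refine LCB.finite_dual hJ hI j q' (h.imp (fun h => ?_) fun h => ?_)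
        · exact ringKrullDim_quotient_le_of_lt ((lt_sup_span hyq).trans_le hq') h
        · exact h.trans (Ideal.radical_mono (sup_le_sup_left (le_sup_left.trans hq') _))
      · intro N₁ N₂ N₃ _ _ _ _ _ _ f g hf hg hfg h₁ h₃
        exact hJ.finite_of_exact (LCB.map_exact (I := I) hf hg hfg j)
    have hex := hJ.exact hδ
    have hlsmul : LinearMap.lcomp B J (LinearMap.lsmul B (LCB I B (j + 1) (B ⧸ q)) y) =
        LinearMap.lsmul B _ y := by
      ext φ x
      simp
    rw [hlsmul] at hex
    have : Module.Finite B ((LCB I B (j + 1) (B ⧸ q) →ₗ[B] J) ⧸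
        LinearMap.range (LinearMap.lsmul B (LCB I B (j + 1) (B ⧸ q) →ₗ[B] J) y)) := by
      refine Module.Finite.of_injective (Submodule.liftQ _ (LinearMap.lcomp B J δ)
        hex.linearMap_ker_eq.ge) ?_
      rw [← LinearMap.ker_eq_bot]
      exact Submodule.ker_liftQ_eq_bot _ _ _ hex.linearMap_ker_eq.le
    have := isPrecomplete_of_le ((Ideal.span_singleton_le_iff_mem _).2 (hI hy))
    refine finite_of_finite_quotient (y := y) fun φ hφ => LinearMap.ext fun x => ?_
    obtain ⟨n, hn⟩ := LCB.exists_pow_smul_eq_zero_of_mem hy x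
    obtain ⟨ψ, rfl⟩ := hφ n
    rw [LinearMap.smul_apply, ← map_smul, hn, map_zero, LinearMap.zero_apply]

/-- Vanishing in the top dimension, prime case. -/
lemma LCB.subsingleton_of_not_le_radical [IsAdicComplete (maximalIdeal B) B]
    (hI : I.map (algebraMap A B) ≤ maximalIdeal B) :
    ∀ (j : ℕ) (q : Ideal B) [q.IsPrime], ringKrullDim (B ⧸ q) ≤ j →
      ¬ maximalIdeal B ≤ (I.map (algebraMap A B) ⊔ q).radical →
      Subsingleton (LCB I B j (B ⧸ q))
  | 0, q, hq, h, h' => by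
    obtain rfl := eq_maximalIdeal_of_ringKrullDim_le_zero h
    exact absurd (le_sup_right.trans Ideal.le_radical) h'
  | j + 1, q, hq, h, h' => by
    obtain ⟨J, _, _, hJ⟩ := exists_isDualizing B
    by_cases hle : I.map (algebraMap A B) ≤ q
    · exact LCB.subsingleton_of_le_prime hle j.succ_pos
    obtain ⟨y, hy, hyq⟩ := SetLike.not_le_iff_exists.1 hle
    obtain ⟨p, hp, hIp, hmp⟩ : ∃ p : Ideal B, p.IsPrime ∧ I.map (algebraMap A B) ⊔ q ≤ p ∧
        ¬ maximalIdeal B ≤ p := by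
      by_contra! hall
      refine h' ?_
      rw [Ideal.radical_eq_sInf]
      exact le_sInf fun p hp => hall p hp.2 hp.1
    obtain ⟨δ, -, hδ⟩ := LCB.exists_bockstein (I := I) (lsmul_quotient_injective hyq) j
    obtain ⟨s, hsp, hs⟩ : ∃ s, s ∉ p ∧ ∀ x : LCB I B j ((B ⧸ q) ⧸
        LinearMap.range (LinearMap.lsmul B (B ⧸ q) y)), s • x = 0 := by
      refine devissage (q ⊔ Ideal.span {y})
        (fun N _ _ => ∃ s, s ∉ p ∧ ∀ x : LCB I B j N, s • x = 0) ?_ ?_ ?_ ?_ _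
        fun a ha x => smul_quotient_range_eq_zero ha x
      · intro N _ _ _
        have := LCB.subsingleton_of_subsingleton (I := I) (B := B) (N := N) j
        exact ⟨1, (Ideal.ne_top_iff_one _).1 hp.ne_top, fun x => Subsingleton.elim _ _⟩
      · rintro N N' _ _ _ _ e ⟨s, hs, h⟩
        exact ⟨s, hs, fun x => (LCB.congr I j e).injective (by rw [map_smul, h, map_zero])⟩
      · intro q' hq'p hq'
        by_cases hmq : maximalIdeal B ≤ (I.map (algebraMap A B) ⊔ q').radical
        · have : ¬ q' ≤ p := fun hle' => hmp <| hmq.trans <|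
            (Ideal.radical_mono (sup_le (le_sup_left.trans hIp) hle')).trans_eq hp.radical
          obtain ⟨s, hs, hsp⟩ := SetLike.not_le_iff_exists.1 this
          refine ⟨s, hsp, LCB.smul_eq_zero j fun x => ?_⟩
          rw [Algebra.smul_def, Ideal.Quotient.algebraMap_eq,
            Ideal.Quotient.eq_zero_iff_mem.2 hs, zero_mul]
        · have := LCB.subsingleton_of_not_le_radical hI j q'
            (ringKrullDim_quotient_le_of_lt ((lt_sup_span hyq).trans_le hq') h) hmq
          exact ⟨1, (Ideal.ne_top_iff_one _).1 hp.ne_top, fun x => Subsingleton.elim _ _⟩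
      · rintro N₁ N₂ N₃ _ _ _ _ _ _ f g hf hg hfg ⟨s, hs, h₁⟩ ⟨t, ht, h₃⟩
        refine ⟨s * t, fun hst => (hp.mem_or_mem hst).elim hs ht, fun x => ?_⟩
        obtain ⟨u, hu⟩ := (LCB.map_exact (I := I) hf hg hfg j (t • x)).1
          (by rw [map_smul, h₃])
        rw [mul_smul, ← hu, ← map_smul, h₁, map_zero]
    have hfin := LCB.finite_dual hJ hI (j + 1) q (Or.inl h)
    have hrange : LinearMap.range (LinearMap.lsmul B (LCB I B (j + 1) (B ⧸ q) →ₗ[B] J) s) ≤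
        Ideal.span {y} • ⊤ := by
      rintro _ ⟨φ, rfl⟩
      obtain ⟨ψ, hψ⟩ := (hJ.exact hδ (s • φ)).1 (by
        ext t
        change s • φ (δ t) = 0
        rw [← map_smul, ← map_smul, hs, map_zero, map_zero])
      have : LinearMap.lsmul B (LCB I B (j + 1) (B ⧸ q) →ₗ[B] J) s φ = y • ψ := by
        refine hψ.symm.trans ?_
        ext t
        simp
      rw [this]
      exact Submodule.smul_mem_smul (Ideal.mem_span_singleton_self y) trivial
    obtain ⟨P, hP, -, hPc, hP0⟩ :=
      LinearMap.exists_monic_and_natDegree_eq_and_coeff_mem_pow_and_aeval_eq_zero B _ _ hrange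
    have haeval : Polynomial.aeval (LinearMap.lsmul B (LCB I B (j + 1) (B ⧸ q) →ₗ[B] J) s) P =
        LinearMap.lsmul B _ (P.eval s) :=
      Polynomial.aeval_algebraMap_apply_eq_algebraMap_eval s P
    rw [haeval] at hP0
    have hap : P.eval s ∉ p := by
      intro hmem
      have hyp : y ∈ p := hIp (Ideal.mem_sup_left hy)
      rw [Polynomial.eval_eq_sum_range, Finset.sum_range_succ, hP.coeff_natDegree, one_mul] at hmem
      have hsum : ∑ i ∈ Finset.range P.natDegree, P.coeff i * s ^ i ∈ p := by
        refine Ideal.sum_mem _ fun i hi => Ideal.mul_mem_right _ _ ?_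
        have h1 := hPc i
        rw [Ideal.span_singleton_pow] at h1
        refine (Ideal.span_singleton_le_iff_mem _).2 (p.pow_mem_of_mem hyp _ ?_) h1
        have := Finset.mem_range.1 hi
        omega
      exact hsp (hp.mem_of_pow_mem _ ((Ideal.add_mem_iff_right _ hsum).1 hmem))
    refine hJ.subsingleton fun φ => LinearMap.ext fun x => ?_
    have haq : P.eval s ∉ q := fun h => hap (hIp (Ideal.mem_sup_right h))
    obtain ⟨z, rfl⟩ := LCB.smul_surjective (by exact_mod_cast h) haq x
    rw [map_smul, ← LinearMap.smul_apply]
    exact LinearMap.congr_fun (LinearMap.congr_fun hP0 φ) z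

end Main

end

section

section Main

variable {A : Type} [CommRing A] [IsNoetherianRing A] {I : Ideal A} {B : Type} [CommRing B]
  [Algebra A B] [IsLocalRing B]

open IsLocalRing

/-- Nonvanishing in the top dimension. -/
lemma LCB.not_subsingleton_of_le_radical [IsNoetherianRing B] [IsAdicComplete (maximalIdeal B) B]
    (hI : I.map (algebraMap A B) ≤ maximalIdeal B) :
    ∀ (j : ℕ) (q : Ideal B) [q.IsPrime], ringKrullDim (B ⧸ q) = j →
      maximalIdeal B ≤ (I.map (algebraMap A B) ⊔ q).radical →
      ¬ Subsingleton (LCB I B j (B ⧸ q))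
  | 0, q, hq, h, h' => by
    intro hsub
    obtain rfl := eq_maximalIdeal_of_ringKrullDim_le_zero h.le
    obtain ⟨t, ht⟩ := LCB.exists_ev_eq (I := I) (B := B) (1 : B ⧸ maximalIdeal B) 1 (fun b hb => by
      rw [pow_one] at hb
      rw [Algebra.smul_def, Ideal.Quotient.algebraMap_eq,
        Ideal.Quotient.eq_zero_iff_mem.2 (hI hb), zero_mul])
    rw [Subsingleton.elim t 0, map_zero] at ht
    exact zero_ne_one ht
  | j + 1, q, hq, h, h' => by
    intro hsub
    obtain ⟨J, _, _, hJ⟩ := exists_isDualizing B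
    have hfin := LCB.finite_dual hJ hI j q (Or.inr h')
    have hqm : ¬ maximalIdeal B ≤ q := by
      intro hle
      obtain rfl := le_antisymm (le_maximalIdeal hq.ne_top) hle
      have h0 : ringKrullDim (B ⧸ maximalIdeal B) = 0 :=
        ringKrullDim_eq_zero_of_isField
          ((Ideal.Quotient.maximal_ideal_iff_isField_quotient _).1 inferInstance)
      rw [h0] at h
      norm_cast at h
    have hassoc := associatedPrimes.finite B (LCB I B j (B ⧸ q) →ₗ[B] J)
    obtain ⟨x, hx, hxn⟩ : ∃ x ∈ maximalIdeal B, x ∉ q ∧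
        ∀ p ∈ associatedPrimes B (LCB I B j (B ⧸ q) →ₗ[B] J), p ≠ maximalIdeal B → x ∉ p := by
      by_contra! hcon
      have hfin' : (insert q (associatedPrimes B (LCB I B j (B ⧸ q) →ₗ[B] J) \
          {maximalIdeal B})).Finite := (hassoc.subset Set.sdiff_subset).insert q
      obtain ⟨p, hp, hmp⟩ := (Ideal.subset_union_prime_finite hfin' (f := id) q q
        (fun p hp hpq _ => by
          rcases hp with rfl | hp
          · exact hq
          · exact hp.1.isPrime)).1 (show (maximalIdeal B : Set B) ⊆ _ from fun x hx => by
            by_cases hxq : x ∈ q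
            · exact Set.mem_biUnion (Set.mem_insert _ _) hxq
            · obtain ⟨p, hp, hpm, hxp⟩ := hcon x hx hxq
              exact Set.mem_biUnion (Set.mem_insert_of_mem _ ⟨hp, hpm⟩) hxp)
      rcases hp with rfl | hp
      · exact hqm hmp
      · exact hp.2 (le_antisymm (le_maximalIdeal hp.1.isPrime.ne_top) hmp)
    obtain ⟨hxq, hxass⟩ := hxn
    obtain ⟨q', hq', hqq', hdim⟩ := exists_prime_le_ringKrullDim_quotient
      (le_ringKrullDim_quotient_sup hx hxq h.ge)
    have hlt : q < q' := (lt_sup_span hxq).trans_le hqq'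
    have hdim' : ringKrullDim (B ⧸ q') = j :=
      le_antisymm (ringKrullDim_quotient_le_of_lt hlt h.le) hdim
    have hrad' : maximalIdeal B ≤ (I.map (algebraMap A B) ⊔ q').radical :=
      h'.trans (Ideal.radical_mono (sup_le_sup_left hlt.le _))
    have ih := LCB.not_subsingleton_of_le_radical hI j q' hdim' hrad'
    let N₁ := (B ⧸ q) ⧸ LinearMap.range (LinearMap.lsmul B (B ⧸ q) x)
    let g₁ : (B ⧸ q) →ₗ[B] N₁ := Submodule.mkQ _
    have hg : q ≤ q' := hlt.le
    let g : (B ⧸ q) →ₗ[B] (B ⧸ q') := Submodule.mapQ q q' LinearMap.id hg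
    have hxg : LinearMap.range (LinearMap.lsmul B (B ⧸ q) x) ≤ LinearMap.ker g := by
      rintro _ ⟨u, rfl⟩
      have hxq' : x ∈ q' := hqq' (Ideal.mem_sup_right (Ideal.mem_span_singleton_self x))
      rw [LinearMap.mem_ker, LinearMap.lsmul_apply, map_smul, Algebra.smul_def,
        Ideal.Quotient.algebraMap_eq, Ideal.Quotient.eq_zero_iff_mem.2 hxq', zero_mul]
    let g₂ : N₁ →ₗ[B] (B ⧸ q') := Submodule.liftQ _ g hxg
    have hg₂ : Function.Surjective g₂ := by
      intro u
      obtain ⟨b, rfl⟩ := Ideal.Quotient.mk_surjective u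
      exact ⟨g₁ (Ideal.Quotient.mk q b), rfl⟩
    have hker₂ : Subsingleton (LCB I B (j + 1) (LinearMap.ker g₂)) := by
      refine LCB.subsingleton_of_dim_lt' (𝔞 := q ⊔ Ideal.span {x}) ?_ _ fun a ha u => ?_
      · refine (ringKrullDim_quotient_le_of_lt (lt_sup_span hxq) h.le).trans_lt ?_
        exact_mod_cast Nat.lt_succ_self j
      · exact Subtype.ext (smul_quotient_range_eq_zero ha u.1)
    have hs₂ : Function.Surjective (LCB.map I j g₂) := LCB.map_surjective hg₂ j
    have hs₁ : Function.Surjective (LCB.map I j g₁) := by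
      obtain ⟨δ, h₁, -⟩ := LCB.exists_bockstein (I := I) (lsmul_quotient_injective hxq) j
      exact fun u => (h₁ u).1 (Subsingleton.elim _ _)
    have hs : Function.Surjective (LCB.map I j g₂ ∘ₗ LCB.map I j g₁) := hs₂.comp hs₁
    rcases j with _ | j
    · have hle : ¬ I.map (algebraMap A B) ≤ q := fun hle => hqm <| by
        rwa [sup_eq_right.2 hle, hq.radical] at h'
      have := LCB.subsingleton_zero_of_not_le hle
      exact ih hs.subsingleton
    · have hinj : Function.Injective
          (LinearMap.lcomp B J (LCB.map I (j + 1) g₂ ∘ₗ LCB.map I (j + 1) g₁)) :=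
        LinearMap.lcomp_injective_of_surjective _ hs
      obtain ⟨φ, hφ⟩ : ∃ φ : LCB I B (j + 1) (B ⧸ q') →ₗ[B] J, φ ≠ 0 := by
        by_contra! hall
        exact ih (hJ.subsingleton hall)
      refine hxass q' ?_ ?_ (hqq' (Ideal.mem_sup_right (Ideal.mem_span_singleton_self x)))
      · rw [AssociatedPrimes.mem_iff, isAssociatedPrime_iff]
        refine ⟨hq', LinearMap.lcomp B J (LCB.map I (j + 1) g₂ ∘ₗ LCB.map I (j + 1) g₁) φ, ?_⟩
        ext a
        rw [Submodule.mem_colon_singleton, Submodule.mem_bot, ← map_smul,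
          (injective_iff_map_eq_zero' _).1 hinj]
        constructor
        · intro ha
          ext u
          rw [LinearMap.smul_apply, ← map_smul, LCB.smul_eq_zero (j + 1) (fun v => ?_) u, map_zero,
            LinearMap.zero_apply]
          rw [Algebra.smul_def, Ideal.Quotient.algebraMap_eq,
            Ideal.Quotient.eq_zero_iff_mem.2 ha, zero_mul]
        · intro ha
          by_contra haq
          refine hφ (LinearMap.ext fun u => ?_)
          obtain ⟨z, rfl⟩ := LCB.smul_surjective (by exact_mod_cast hdim'.le) haq u
          rw [map_smul, ← LinearMap.smul_apply, ha]
          rfl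
      · rintro rfl
        have h0 : ringKrullDim (B ⧸ maximalIdeal B) = 0 :=
          ringKrullDim_eq_zero_of_isField
            ((Ideal.Quotient.maximal_ideal_iff_isField_quotient _).1 inferInstance)
        rw [h0] at hdim'
        norm_cast at hdim'

lemma maximalIdeal_le_radical_iff {𝔞 : Ideal B} :
    maximalIdeal B ≤ 𝔞.radical ↔ ¬ 0 < ringKrullDim (B ⧸ 𝔞) := by
  constructor
  · intro h h0
    obtain ⟨p, hp, h𝔞p, h1⟩ := exists_prime_le_ringKrullDim_quotient (𝔟 := 𝔞) (n := 1)
      (by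
        generalize ringKrullDim (B ⧸ 𝔞) = e at h0
        induction e with
        | bot => simp at h0
        | coe e => exact_mod_cast Order.one_le_iff_pos.2 (by exact_mod_cast h0))
    have hpm : p = maximalIdeal B := le_antisymm (le_maximalIdeal hp.ne_top)
      (h.trans ((Ideal.radical_mono h𝔞p).trans_eq hp.radical))
    rw [hpm, ringKrullDim_eq_zero_of_isField
      ((Ideal.Quotient.maximal_ideal_iff_isField_quotient _).1 inferInstance)] at h1
    norm_cast at h1
  · intro h
    rw [Ideal.radical_eq_sInf]
    refine le_sInf fun p hp => (@eq_maximalIdeal_of_ringKrullDim_le_zero _ _ _ p hp.2 ?_).ge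
    exact (ringKrullDim_quotient_antitone hp.1).trans (not_lt.1 h)

/-- The Hartshorne–Lichtenbaum theorem over a complete local ring. -/
theorem LCB.subsingleton_top_iff [IsNoetherianRing B] [IsAdicComplete (maximalIdeal B) B]
    (hI : I.map (algebraMap A B) ≤ maximalIdeal B) {d : ℕ} (hd : ringKrullDim B ≤ d) :
    Subsingleton (LCB I B d B) ↔ ∀ P ∈ minimalPrimes B, (d : WithBot ℕ∞) = ringKrullDim (B ⧸ P) →
      0 < ringKrullDim (B ⧸ (I.map (algebraMap A B) ⊔ P)) := by
  have hbot : ringKrullDim (B ⧸ (⊥ : Ideal B)) ≤ d := (ringKrullDim_quotient_le _).trans hd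
  constructor
  · intro hsub P hP hPd
    have hPp : P.IsPrime := hP.1.1
    by_contra h0
    rw [← maximalIdeal_le_radical_iff] at h0
    refine LCB.not_subsingleton_of_le_radical hI d P hPd.symm h0 ?_
    have : Subsingleton (LCB I B (d + 1) (LinearMap.ker P.mkQ)) := by
      refine LCB.subsingleton_of_dim_lt' (𝔞 := ⊥) (hbot.trans_lt ?_) _ fun a ha x => ?_
      · exact_mod_cast Nat.lt_succ_self d
      · rw [Ideal.mem_bot.1 ha, zero_smul]
    exact (LCB.map_surjective (I := I) P.mkQ_surjective d).subsingleton
  · intro h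
    refine LCB.subsingleton_of_forall_prime ⊥ (fun q hq _ => ?_) B
      fun a ha x => by rw [Ideal.mem_bot.1 ha, zero_smul]
    have hqd := (ringKrullDim_quotient_le q).trans hd
    rcases hqd.lt_or_eq with hlt | heq
    · exact LCB.subsingleton_of_dim_lt d q hlt
    refine LCB.subsingleton_of_not_le_radical hI d q hqd ?_
    rw [maximalIdeal_le_radical_iff, not_not]
    refine h q ?_ heq.symm
    obtain ⟨p, hp, hpq⟩ := Ideal.exists_minimalPrimes_le (J := q) (I := ⊥) bot_le
    rcases hpq.lt_or_eq with hlt | rfl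
    · have hpp : p.IsPrime := hp.1.1
      have h1 := (ringKrullDim_quotient_succ_le hlt).trans ((ringKrullDim_quotient_le p).trans hd)
      rw [heq] at h1
      norm_cast at h1
      omega
    · exact hp

end Main

end

section

open IsLocalRing TensorProduct

section Completion

variable {A : Type} [CommRing A] [IsNoetherianRing A]

/-- Extensions of ideals to the completion are closed. -/
lemma mem_map_of_forall_mem_sup {J 𝔠 : Ideal A} {b : AdicCompletion J A}
    (hb : ∀ n, b ∈ 𝔠.map (algebraMap A (AdicCompletion J A)) ⊔
      (J ^ n).map (algebraMap A (AdicCompletion J A))) :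
    b ∈ 𝔠.map (algebraMap A (AdicCompletion J A)) := by
  set y : AdicCompletion J (A ⧸ 𝔠) := AdicCompletion.of J (A ⧸ 𝔠) 1
  have h1 : ∀ c ∈ 𝔠.map (algebraMap A (AdicCompletion J A)), c • y = 0 := by
    intro c hc
    induction hc using Submodule.span_induction with
    | mem x hx =>
      obtain ⟨a, ha, rfl⟩ := hx
      rw [algebraMap_smul, ← map_smul, Algebra.smul_def, mul_one,
        Ideal.Quotient.algebraMap_eq, Ideal.Quotient.eq_zero_iff_mem.2 ha, map_zero]
    | zero => simp
    | add x z _ _ hx hz => rw [add_smul, hx, hz, add_zero]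
    | smul r x _ hx => rw [smul_eq_mul, mul_smul, hx, smul_zero]
  have h2 : ∀ n, ∀ z ∈ (J ^ n).map (algebraMap A (AdicCompletion J A)),
      ∀ w : AdicCompletion J (A ⧸ 𝔠),
        z • w ∈ (J ^ n • ⊤ : Submodule A (AdicCompletion J (A ⧸ 𝔠))) := by
    intro n z hz
    induction hz using Submodule.span_induction with
    | mem x hx =>
      obtain ⟨a, ha, rfl⟩ := hx
      intro w
      rw [algebraMap_smul]
      exact Submodule.smul_mem_smul ha trivial
    | zero => simp
    | add x z _ _ hx hz => intro w; rw [add_smul]; exact add_mem (hx w) (hz w)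
    | smul r x _ hx => intro w; rw [smul_eq_mul, mul_comm, mul_smul]; exact hx _
  have h3 : b • y = 0 := by
    refine IsHausdorff.haus (I := J) inferInstance _ fun n => ?_
    rw [SModEq.zero]
    obtain ⟨c, hc, z, hz, rfl⟩ := Submodule.mem_sup.1 (hb n)
    rw [add_smul, h1 c hc, zero_add]
    exact h2 n z hz y
  have h4 : b ⊗ₜ[A] (1 : A ⧸ 𝔠) = 0 := by
    refine (AdicCompletion.ofTensorProduct_bijective_of_finite_of_isNoetherian J (A ⧸ 𝔠)).1 ?_
    rw [AdicCompletion.ofTensorProduct_tmul, map_zero]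
    exact h3
  have h5 := congrArg (tensorQuotEquivQuotSMul (AdicCompletion J A) 𝔠) h4
  rw [map_zero] at h5
  have h6 : tensorQuotEquivQuotSMul (AdicCompletion J A) 𝔠 (b ⊗ₜ[A] (1 : A ⧸ 𝔠)) =
      Submodule.Quotient.mk b := by
    simpa using tensorQuotEquivQuotSMul_tmul_mk 𝔠 b 1
  rw [h6, Submodule.Quotient.mk_eq_zero, Ideal.smul_top_eq_map] at h5
  exact h5

lemma isHausdorff_quotient_map (J 𝔠 : Ideal A) :
    IsHausdorff (J.map (algebraMap A (AdicCompletion J A)))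
      (AdicCompletion J A ⧸ 𝔠.map (algebraMap A (AdicCompletion J A))) := by
  refine ⟨fun x hx => ?_⟩
  obtain ⟨b, rfl⟩ := Ideal.Quotient.mk_surjective x
  rw [Ideal.Quotient.eq_zero_iff_mem]
  refine mem_map_of_forall_mem_sup fun n => ?_
  have := hx n
  rw [SModEq.zero, ← Ideal.map_pow, Ideal.smul_top_eq_map] at this
  have h' := (Ideal.mem_map_iff_of_surjective _ Ideal.Quotient.mk_surjective).1 this
  obtain ⟨z, hz, hz'⟩ := h'
  rw [Ideal.Quotient.mk_eq_mk_iff_sub_mem] at hz'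
  have := Ideal.sub_mem _ (Ideal.mem_sup_right (S := 𝔠.map (algebraMap A (AdicCompletion J A))) hz)
    (Ideal.mem_sup_left hz')
  simpa using this

lemma isPrecomplete_span_algebraMap {J : Ideal A} {x : A} (hx : x ∈ J) :
    IsPrecomplete (Ideal.span {algebraMap A (AdicCompletion J A) x}) (AdicCompletion J A) := by
  have := AdicCompletion.isAdicComplete_self J J.fg_of_isNoetherianRing
  refine isPrecomplete_of_le_of_isHausdorff
    (𝔪 := J.map (algebraMap A (AdicCompletion J A))) ?_ fun n => ?_
  · rw [Ideal.span_singleton_le_iff_mem]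
    exact Ideal.mem_map_of_mem _ hx
  · have := isHausdorff_quotient_map J (Ideal.span {x ^ n})
    rw [Ideal.map_span, Set.image_singleton, map_pow, ← Ideal.span_singleton_pow] at this
    exact this

lemma isNoetherian_of_surjective_algebraMap {B D : Type*} [CommRing B] [CommRing D] [Algebra B D]
    [IsNoetherianRing D] (h : Function.Surjective (algebraMap B D)) : IsNoetherian B D := by
  refine ⟨fun s => ?_⟩
  let s' : Ideal D :=
    { s with
      smul_mem' := fun c x hx => by
        obtain ⟨b, rfl⟩ := h c
        rw [algebraMap_smul]
        exact s.smul_mem b hx }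
  exact Submodule.FG.restrictScalars_of_surjective (S := s') s'.fg_of_isNoetherianRing h

lemma isNoetherianRing_quotient_map [IsLocalRing A] {B : Type} [CommRing B] [IsLocalRing B]
    [Algebra A B] (hmax : maximalIdeal B = (maximalIdeal A).map (algebraMap A B))
    (hpre : ∀ x ∈ maximalIdeal A, IsPrecomplete (Ideal.span {algebraMap A B x}) B)
    (hhaus : ∀ 𝔠 : Ideal A, IsHausdorff (maximalIdeal B) (B ⧸ 𝔠.map (algebraMap A B)))
    (𝔠 : Ideal A) : IsNoetherianRing (B ⧸ 𝔠.map (algebraMap A B)) := by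
  refine IsNoetherian.induction
    (P := fun 𝔠 : Ideal A => IsNoetherianRing (B ⧸ 𝔠.map (algebraMap A B)))
    (fun (𝔠 : Ideal A) ih => ?_) 𝔠
  refine IsNoetherianRing.of_prime fun p hp => ?_
  by_cases hm : ∀ x ∈ maximalIdeal A, algebraMap A (B ⧸ 𝔠.map (algebraMap A B)) x ∈ p
  · have hp' : p = (maximalIdeal A).map (algebraMap A (B ⧸ 𝔠.map (algebraMap A B))) := by
      refine le_antisymm ?_ (Ideal.map_le_iff_le_comap.2 hm)
      have h1 : p.comap (Ideal.Quotient.mk (𝔠.map (algebraMap A B))) ≤ maximalIdeal B :=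
        le_maximalIdeal (Ideal.comap_ne_top _ hp.ne_top)
      rw [← Ideal.map_comap_of_surjective _ Ideal.Quotient.mk_surjective p]
      refine (Ideal.map_mono h1).trans ?_
      rw [hmax, Ideal.map_map]
      exact le_rfl
    rw [hp']
    exact (maximalIdeal A).fg_of_isNoetherianRing.map _
  · push Not at hm
    obtain ⟨x, hx, hxp⟩ := hm
    set C := B ⧸ 𝔠.map (algebraMap A B)
    have hx𝔠 : x ∉ 𝔠 := fun h => hxp (by
      have : algebraMap A C x = 0 := Ideal.Quotient.eq_zero_iff_mem.2 (Ideal.mem_map_of_mem _ h)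
      rw [this]; exact p.zero_mem)
    have hlt : 𝔠 < 𝔠 ⊔ Ideal.span {x} := by
      refine lt_of_le_of_ne le_sup_left fun h => hx𝔠 ?_
      rw [h]
      exact Ideal.mem_sup_right (Ideal.mem_span_singleton_self x)
    have hN := ih _ hlt
    set D := B ⧸ (𝔠 ⊔ Ideal.span {x}).map (algebraMap A B)
    let π : C →ₐ[B] D := Ideal.Quotient.factorₐ B (Ideal.map_mono le_sup_left)
    have hDB : IsNoetherian B D := isNoetherian_of_surjective_algebraMap
      Ideal.Quotient.mk_surjective
    have := hpre x hx
    let P : Submodule B C := p.restrictScalars B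
    have hfin : Module.Finite B P := by
      let φ : P →ₗ[B] D := π.toLinearMap ∘ₗ P.subtype
      have hker : LinearMap.ker φ ≤ LinearMap.range (LinearMap.lsmul B P (algebraMap A B x)) := by
        rintro ⟨c, hc⟩ hcφ
        obtain ⟨b, rfl⟩ := Ideal.Quotient.mk_surjective c
        have hb : Ideal.Quotient.mk ((𝔠 ⊔ Ideal.span {x}).map (algebraMap A B)) b = 0 := hcφ
        rw [Ideal.Quotient.eq_zero_iff_mem, Ideal.map_sup, Ideal.map_span,
          Set.image_singleton] at hb
        obtain ⟨u, hu, v, hv, rfl⟩ := Submodule.mem_sup.1 hb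
        obtain ⟨t, rfl⟩ := Ideal.mem_span_singleton'.1 hv
        have hc' : Ideal.Quotient.mk (𝔠.map (algebraMap A B)) (u + t * algebraMap A B x) =
            Ideal.Quotient.mk (𝔠.map (algebraMap A B)) t * algebraMap A C x := by
          rw [map_add, Ideal.Quotient.eq_zero_iff_mem.2 hu, zero_add, map_mul]
          rfl
        have hc2 : Ideal.Quotient.mk (𝔠.map (algebraMap A B)) t * algebraMap A C x ∈ p := by
          rw [← hc']; exact hc
        refine ⟨⟨Ideal.Quotient.mk _ t, (hp.mem_or_mem hc2).resolve_right hxp⟩, ?_⟩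
        refine Subtype.ext ?_
        change algebraMap A B x • (Ideal.Quotient.mk (𝔠.map (algebraMap A B)) t) = _
        refine Eq.trans ?_ hc'.symm
        rw [mul_comm, Algebra.smul_def]
        rfl
      have : Module.Finite B (P ⧸ LinearMap.range (LinearMap.lsmul B P (algebraMap A B x))) := by
        have h1 : Module.Finite B (P ⧸ LinearMap.ker φ) :=
          Module.Finite.of_injective _
            (LinearMap.ker_eq_bot.1 (Submodule.ker_liftQ_eq_bot _ φ le_rfl le_rfl))
        exact Module.Finite.of_surjective (Submodule.factor hker)
          (Submodule.factor_surjective hker)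
      refine finite_of_finite_quotient (y := algebraMap A B x) fun c hc => ?_
      have hH := hhaus 𝔠
      refine Subtype.ext (IsHausdorff.haus hH _ fun n => ?_)
      rw [SModEq.zero]
      obtain ⟨z, rfl⟩ := hc n
      refine Submodule.smul_mem_smul (Ideal.pow_mem_pow ?_ n) trivial
      rw [hmax]
      exact Ideal.mem_map_of_mem _ hx
    exact Submodule.FG.of_restrictScalars B (Module.Finite.iff_fg.1 hfin)

instance isNoetherianRing_adicCompletion [IsLocalRing A] :
    IsNoetherianRing (AdicCompletion (maximalIdeal A) A) := by
  have := isNoetherianRing_quotient_map (B := AdicCompletion (maximalIdeal A) A)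
    AdicCompletion.maximalIdeal_eq_map (fun _ => isPrecomplete_span_algebraMap) (fun 𝔠 => by
      rw [AdicCompletion.maximalIdeal_eq_map]
      exact isHausdorff_quotient_map _ 𝔠) (⊥ : Ideal A)
  rw [Ideal.map_bot] at this
  exact isNoetherianRing_of_ringEquiv _ (RingEquiv.quotientBot _)

lemma ringKrullDim_adicCompletion_le [IsLocalRing A] :
    ringKrullDim (AdicCompletion (maximalIdeal A) A) ≤ ringKrullDim A := by
  have h := Ideal.height_le_height_add_of_liesOver (maximalIdeal A)
    (maximalIdeal (AdicCompletion (maximalIdeal A) A))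
  rw [← AdicCompletion.maximalIdeal_eq_map, Ideal.map_quotient_self, Ideal.height_bot,
    add_zero] at h
  rw [← maximalIdeal_height_eq_ringKrullDim, ← maximalIdeal_height_eq_ringKrullDim]
  exact_mod_cast h

end Completion

end

section

open CategoryTheory.Abelian IsLocalRing

section Flat

variable {A : Type} [CommRing A] [IsNoetherianRing A] {M : ModuleCat.{0} A} [Module.Flat A M]

lemma exists_eq_comp_of_flat (j : ℕ) : ∀ (X : ModuleCat.{0} A) [Module.Finite A X]
    (x : Ext X M j), ∃ (k : ℕ) (y : Ext X (ModuleCat.of A (Fin k →₀ A)) j)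
      (g : ModuleCat.of A (Fin k →₀ A) ⟶ M), y.comp (Ext.mk₀ g) (add_zero j) = x := by
  induction j with
  | zero =>
    intro X _ x
    obtain ⟨f, rfl⟩ := (Ext.mk₀_bijective X M).2 x
    have := Module.finitePresentation_of_finite A X
    obtain ⟨k, h₂, h₃, h⟩ := Module.Flat.exists_factorization_of_finitePresentation f.hom
    refine ⟨k, Ext.mk₀ (ModuleCat.ofHom h₂), ModuleCat.ofHom h₃, ?_⟩
    rw [Ext.mk₀_comp_mk₀, ← ModuleCat.ofHom_comp, ← h]
    rfl
  | succ j ih =>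
    intro X _ x
    obtain ⟨F, _, _, _, _, f, hf⟩ := Module.exists_finite_presentation A X
    have hS := LinearMap.shortExact_shortComplexKer hf
    obtain ⟨y, hy⟩ := precomp_extClass_surjective_of_projective_X₂ M hS j x
    have hy' : hS.extClass.comp y (add_comm 1 j) = x := hy
    obtain ⟨k, z, g, rfl⟩ := ih (ModuleCat.of A (LinearMap.ker f)) y
    refine ⟨k, hS.extClass.comp z (add_comm 1 j), g, ?_⟩
    rw [← hy']
    exact Ext.comp_assoc _ _ _ _ _ (by lia)

omit [IsNoetherianRing A] in
lemma LC.subsingleton_of_free {I : Ideal A} {j : ℕ} [Subsingleton (LC I j (ModuleCat.of A A))]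
    (k : ℕ) : Subsingleton (LC I j (ModuleCat.of A (Fin k →₀ A))) := by
  refine subsingleton_of_forall_eq 0 fun x => ?_
  let Φ : (ModuleCat.of A (Fin k →₀ A) ⟶ ModuleCat.of A (Fin k →₀ A)) →+
      LC I j (ModuleCat.of A (Fin k →₀ A)) :=
    AddMonoidHom.mk' (fun f => LC.post (Ext.mk₀ f) (add_zero j) x) fun f g => by
      rw [Ext.mk₀_add, LC.post_add]
  have h1 : (𝟙 (ModuleCat.of A (Fin k →₀ A))) =
      ∑ i, ModuleCat.ofHom (Finsupp.lapply (R := A) i) ≫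
        ModuleCat.ofHom (Finsupp.lsingle (R := A) (M := A) i) := by
    ext v
    simp [ModuleCat.hom_sum]
  have h2 : Φ (𝟙 _) = 0 := by
    rw [h1, map_sum]
    refine Finset.sum_eq_zero fun i _ => ?_
    change LC.post (Ext.mk₀ _) (add_zero j) x = 0
    have := LC.post_post (Ext.mk₀ (ModuleCat.ofHom (Finsupp.lapply (R := A) (M := A) i)))
      (Ext.mk₀ (ModuleCat.ofHom (Finsupp.lsingle (R := A) (M := A) i)))
      (add_zero j) (add_zero j) (add_zero 0) x
    rw [Ext.mk₀_comp_mk₀] at this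
    rw [← this, Subsingleton.elim (LC.post (Ext.mk₀ (ModuleCat.ofHom
      (Finsupp.lapply (R := A) (M := A) i))) (add_zero j) x) 0, map_zero]
  exact (LC.post_id x).symm.trans h2

lemma LC.subsingleton_of_flat {I : Ideal A} {j : ℕ} [Subsingleton (LC I j (ModuleCat.of A A))] :
    Subsingleton (LC I j M) := by
  refine subsingleton_of_forall_eq 0 fun x => ?_
  obtain ⟨n, c, rfl⟩ := x.exists_of
  obtain ⟨k, y, g, rfl⟩ := exists_eq_comp_of_flat j _ c
  have := LC.subsingleton_of_free (I := I) (j := j) k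
  rw [← LC.post_of, Subsingleton.elim (LC.of I j _ n y) 0, map_zero]

variable [IsLocalRing A] (ι : A →ₗ[A] M) (hι : ι 1 ∉ (maximalIdeal A • ⊤ : Submodule A M))
include hι

lemma exists_extension {F : Type} [AddCommGroup F] [Module A F] [Module.Finite A F]
    (K : Submodule A F) (y : K →ₗ[A] A) (φ : F →ₗ[A] M) (h : ι ∘ₗ y = φ ∘ₗ K.subtype) :
    ∃ ψ : F →ₗ[A] A, ψ ∘ₗ K.subtype = y := by
  let R : Submodule A (F × A) := LinearMap.range (K.subtype.prod (-y))
  let γ : ((F × A) ⧸ R) →ₗ[A] M := R.liftQ (φ.coprod ι) (by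
    rintro _ ⟨x, rfl⟩
    have := LinearMap.congr_fun h x
    simp only [LinearMap.comp_apply, Submodule.subtype_apply] at this
    simp [this])
  have := Module.finitePresentation_of_finite A ((F × A) ⧸ R)
  obtain ⟨k, h₂, h₃, hγ⟩ := Module.Flat.exists_factorization_of_finitePresentation γ
  set v : Fin k →₀ A := h₂ (R.mkQ (0, 1))
  have hv : h₃ v = ι 1 := by
    have := LinearMap.congr_fun hγ (R.mkQ (0, 1))
    rw [LinearMap.comp_apply] at this
    rw [← this]
    simp [γ]
  obtain ⟨i, hi⟩ : ∃ i, IsUnit (v i) := by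
    by_contra! hcon
    refine hι ?_
    rw [← hv, ← Finsupp.sum_single v, Finsupp.sum, map_sum]
    refine Submodule.sum_mem _ fun i _ => ?_
    rw [← mul_one (v i), ← smul_eq_mul, ← Finsupp.smul_single, map_smul]
    exact Submodule.smul_mem_smul (hcon i) trivial
  obtain ⟨u, hu⟩ := hi
  let ρ : ((F × A) ⧸ R) →ₗ[A] A := (↑u⁻¹ : A) • (Finsupp.lapply i ∘ₗ h₂)
  have hρ : ρ (R.mkQ (0, 1)) = 1 := by
    change (↑u⁻¹ : A) * (v i) = 1
    rw [← hu, Units.inv_mul]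
  refine ⟨ρ ∘ₗ R.mkQ ∘ₗ LinearMap.inl A F A, LinearMap.ext fun x => ?_⟩
  have h1 : R.mkQ ((x : F), -(y x)) = 0 := by
    rw [Submodule.mkQ_apply, Submodule.Quotient.mk_eq_zero]
    exact ⟨x, rfl⟩
  have h2 : ((x : F), (0 : A)) = ((x : F), -(y x)) + y x • ((0 : F), (1 : A)) := by simp
  change ρ (R.mkQ ((x : F), (0 : A))) = y x
  rw [h2, map_add, h1, zero_add, map_smul, map_smul, hρ, smul_eq_mul, mul_one]

lemma ext_postcomp_injective (hinj : Function.Injective ι) (j : ℕ) :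
    ∀ (X : ModuleCat.{0} A) [Module.Finite A X] (x : Ext X (ModuleCat.of A A) j),
      x.comp (Ext.mk₀ (ModuleCat.ofHom ι)) (add_zero j) = 0 → x = 0 := by
  induction j with
  | zero =>
    intro X _ x hx
    obtain ⟨f, rfl⟩ := (Ext.mk₀_bijective X _).2 x
    rw [Ext.mk₀_comp_mk₀, Ext.mk₀_eq_zero_iff] at hx
    rw [Ext.mk₀_eq_zero_iff]
    ext v
    refine hinj ?_
    have := congrArg (fun g => g.hom v) hx
    simpa using this
  | succ j ih =>
    intro X _ x hx
    obtain ⟨F, _, _, _, _, f, hf⟩ := Module.exists_finite_presentation A X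
    have hS := LinearMap.shortExact_shortComplexKer hf
    obtain ⟨y, hy⟩ := precomp_extClass_surjective_of_projective_X₂ _ hS j x
    have hy' : hS.extClass.comp y (add_comm 1 j) = x := hy
    subst hy'
    rw [Ext.comp_assoc _ _ _ (add_comm 1 j) (add_zero j) (by lia)] at hx
    obtain ⟨z, hz⟩ := Ext.contravariant_sequence_exact₁ hS M _ (add_comm 1 j) hx
    suffices h : ∃ w : Ext (ModuleCat.of A F) (ModuleCat.of A A) j,
        (Ext.mk₀ f.shortComplexKer.f).comp w (zero_add j) = y by
      obtain ⟨w, rfl⟩ := h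
      exact hS.extClass_comp_assoc _
    cases j with
    | zero =>
      obtain ⟨y, rfl⟩ := (Ext.mk₀_bijective _ _).2 y
      obtain ⟨z, rfl⟩ := (Ext.mk₀_bijective _ _).2 z
      rw [Ext.mk₀_comp_mk₀, Ext.mk₀_comp_mk₀] at hz
      have hz' := (Ext.mk₀_bijective _ _).1 hz
      obtain ⟨ψ, hψ⟩ := exists_extension ι hι (LinearMap.ker f) y.hom z.hom
        (by simpa using (congrArg ModuleCat.Hom.hom hz').symm)
      refine ⟨Ext.mk₀ (ModuleCat.ofHom ψ), ?_⟩
      rw [Ext.mk₀_comp_mk₀]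
      congr 1
      ext1
      exact hψ
    | succ j =>
      refine ⟨0, ?_⟩
      have hz0 : z = 0 := Ext.eq_zero_of_projective z
      rw [hz0, Ext.comp_zero] at hz
      rw [Ext.comp_zero, ih (ModuleCat.of A (LinearMap.ker f)) y hz.symm]

lemma LC.subsingleton_of_flat_local (hinj : Function.Injective ι) {I : Ideal A} {j : ℕ}
    [Subsingleton (LC I j M)] : Subsingleton (LC I j (ModuleCat.of A A)) := by
  refine subsingleton_of_forall_eq 0 fun x => ?_
  obtain ⟨n, c, rfl⟩ := x.exists_of
  have h := Subsingleton.elim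
    (LC.post (Ext.mk₀ (ModuleCat.ofHom ι)) (add_zero j) (LC.of I j _ n c)) 0
  rw [LC.post_of, LC.of_eq_zero_iff] at h
  obtain ⟨m, hm, h⟩ := h
  rw [LC.of_eq_zero_iff]
  refine ⟨m, hm, ext_postcomp_injective ι hι hinj j _ _ ?_⟩
  rw [trans_apply] at h ⊢
  rw [← h]
  exact Ext.comp_assoc _ _ _ _ _ (by lia)

lemma LC.subsingleton_iff_of_flat_local (hinj : Function.Injective ι) {I : Ideal A} {j : ℕ} :
    Subsingleton (LC I j (ModuleCat.of A A)) ↔ Subsingleton (LC I j M) :=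
  ⟨fun _ => LC.subsingleton_of_flat, fun _ => LC.subsingleton_of_flat_local ι hι hinj⟩

end Flat

section Completion

variable {A B : Type} [CommRing A] [CommRing B] [Algebra A B]

/-- Restriction of scalars does not change the `A`-module structure of `B`. -/
noncomputable def linearEquivRs : B ≃ₗ[A] rs A (B := B) B :=
  { AddEquiv.refl B with
    map_smul' := fun a b => Algebra.smul_def a b }

lemma subsingleton_iff_LCB [IsNoetherianRing A] [IsLocalRing A] [IsLocalRing B]
    [Module.Flat A B] (hB : (maximalIdeal A).map (algebraMap A B) ≤ maximalIdeal B)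
    (hinj : Function.Injective (algebraMap A B)) (I : Ideal A) (j : ℕ) :
    Subsingleton (LC I j (ModuleCat.of A A)) ↔ Subsingleton (LCB I B j B) := by
  have : Module.Flat A (rs A (B := B) B) := Module.Flat.of_linearEquiv (linearEquivRs (A := A) (B := B)).symm
  refine LC.subsingleton_iff_of_flat_local
    ((linearEquivRs (A := A) (B := B)).toLinearMap ∘ₗ Algebra.linearMap A B) (fun h => ?_)
    ((linearEquivRs (A := A) (B := B)).injective.comp hinj)
  have h1 := Submodule.mem_map_of_mem (f := (linearEquivRs (A := A) (B := B)).symm.toLinearMap) h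
  rw [Submodule.map_smul'', Submodule.map_top, LinearEquiv.range, Ideal.smul_top_eq_map] at h1
  have h2 : (1 : B) ∈ (maximalIdeal A).map (algebraMap A B) := by
    simpa using h1
  exact (maximalIdeal B).one_notMem (hB h2)

lemma LC.subsingleton_iff_adicCompletion {A : Type} [CommRing A] [IsNoetherianRing A]
    [IsLocalRing A] (I : Ideal A) (hI : I ≠ ⊤) (d : ℕ) (hd : (d : WithBot ℕ∞) = ringKrullDim A) :
    Subsingleton (LC I d (ModuleCat.of A A)) ↔
      ∀ P ∈ minimalPrimes (AdicCompletion (maximalIdeal A) A),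
        (d : WithBot ℕ∞) = ringKrullDim (AdicCompletion (maximalIdeal A) A ⧸ P) →
          0 < ringKrullDim (AdicCompletion (maximalIdeal A) A ⧸
            (Ideal.map (algebraMap A (AdicCompletion (maximalIdeal A) A)) I ⊔ P)) := by
  have hB : (maximalIdeal A).map (algebraMap A (AdicCompletion (maximalIdeal A) A)) ≤
      maximalIdeal (AdicCompletion (maximalIdeal A) A) := AdicCompletion.maximalIdeal_eq_map.ge
  rw [subsingleton_iff_LCB (B := AdicCompletion (maximalIdeal A) A) hB
    (AdicCompletion.of_injective (maximalIdeal A) A) I d]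
  exact LCB.subsingleton_top_iff ((Ideal.map_mono (le_maximalIdeal hI)).trans hB)
    (ringKrullDim_adicCompletion_le.trans hd.ge)

lemma LC.subsingleton_of_isDomain {A : Type} [CommRing A] [IsNoetherianRing A]
    [IsLocalRing A] [IsDomain A] [IsAdicComplete (maximalIdeal A) A] (I : Ideal A) (hI : I ≠ ⊤)
    (d : ℕ) (hd : (d : WithBot ℕ∞) = ringKrullDim A) (h : I.radical ≠ maximalIdeal A) :
    Subsingleton (LC I d (ModuleCat.of A A)) := by
  have hB : (maximalIdeal A).map (algebraMap A A) ≤ maximalIdeal A := by simp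
  have hmap : I.map (algebraMap A A) = I := by simp
  rw [subsingleton_iff_LCB (B := A) hB (fun _ _ h => h) I d,
    LCB.subsingleton_top_iff (hmap.le.trans (le_maximalIdeal hI)) hd.ge]
  intro P hP _
  rw [IsDomain.minimalPrimes_eq_singleton_bot, Set.mem_singleton_iff] at hP
  rw [hP, hmap, sup_bot_eq]
  by_contra hcon
  rw [← maximalIdeal_le_radical_iff] at hcon
  exact h (le_antisymm ((Ideal.IsPrime.radical_le_iff inferInstance).2 (le_maximalIdeal hI)) hcon)

end Completion

end

section

open Limits Opposite

section OpHomology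

variable {R : Type} [CommRing R]

/-- `c` is a cocycle representing the homology class `x`, for a complex in the opposite category. -/
def Represents (K : ChainComplex (ModuleCat.{0} R)ᵒᵖ ℕ) (n : ℕ) (c : (K.X n).unop)
    (x : (K.homology n).unop) : Prop :=
  ∃ z : (K.opcycles n).unop, (K.pOpcycles n).unop z = c ∧ (K.homologyι n).unop z = x

variable {K L : ChainComplex (ModuleCat.{0} R)ᵒᵖ ℕ} {n : ℕ}

lemma Represents.exists_cocycle (x : (K.homology n).unop) : ∃ c, Represents K n c x := by
  obtain ⟨z, rfl⟩ := (ModuleCat.epi_iff_surjective (K.homologyι n).unop).1 inferInstance x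
  exact ⟨_, z, rfl, rfl⟩

lemma Represents.d_eq_zero {c : (K.X n).unop} {x} (h : Represents K n c x) (m : ℕ) :
    (K.d m n).unop c = 0 := by
  obtain ⟨z, rfl, -⟩ := h
  have := congrArg (fun f => f.unop z) (K.d_pOpcycles m n)
  exact this

lemma Represents.exists_class (c : (K.X n).unop) (m : ℕ) (hm : n + 1 = m)
    (hc : (K.d m n).unop c = 0) : ∃ x, Represents K n c x := by
  let φ : ModuleCat.of R R ⟶ (K.X n).unop := ModuleCat.ofHom (LinearMap.toSpanSingleton R _ c)
  let k : K.opcycles n ⟶ op (ModuleCat.of R R) :=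
    K.descOpcycles (k := φ.op) m (by simp [hm]) (Quiver.Hom.unop_inj (by
      ext
      simpa [φ] using hc))
  refine ⟨_, k.unop (1 : R), ?_, rfl⟩
  have := congrArg (fun f => f.unop (1 : R)) (K.p_descOpcycles φ.op m (by simp [hm])
    (Quiver.Hom.unop_inj (by
      ext
      simpa [φ] using hc)))
  exact this.trans (one_smul R c)

lemma Represents.map {c : (L.X n).unop} {x} (f : K ⟶ L) (h : Represents L n c x) :
    Represents K n ((f.f n).unop c) ((HomologicalComplex.homologyMap f n).unop x) := by
  obtain ⟨z, rfl, rfl⟩ := h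
  refine ⟨(HomologicalComplex.opcyclesMap f n).unop z, ?_, ?_⟩
  · exact congrArg (fun f => f.unop z) (HomologicalComplex.p_opcyclesMap f n)
  · exact congrArg (fun f => f.unop z) (HomologicalComplex.homologyι_naturality f n).symm

lemma Represents.eq_zero_iff {c : (K.X n).unop} {x} (h : Represents K n c x) (p : ℕ)
    (hp : (ComplexShape.down ℕ).next n = p) :
    x = 0 ↔ ∃ b, (K.d n p).unop b = c := by
  have hS := (ShortComplex.exact_of_f_is_kernel (ShortComplex.mk _ _
    (K.homologyι_comp_fromOpcycles n p)) (K.homologyIsKernel n p hp)).unop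
  rw [ShortComplex.moduleCat_exact_iff] at hS
  have hd (b) : (K.d n p).unop b = (K.pOpcycles n).unop ((K.fromOpcycles n p).unop b) :=
    congrArg (fun f => f.unop b) (K.p_fromOpcycles n p).symm
  have hι (b) : (K.homologyι n).unop ((K.fromOpcycles n p).unop b) = 0 :=
    congrArg (fun f => f.unop b) (K.homologyι_comp_fromOpcycles n p)
  obtain ⟨z, rfl, rfl⟩ := h
  constructor
  · intro hz
    obtain ⟨b, hb⟩ := hS z hz
    exact ⟨b, (hd b).trans (congrArg _ hb)⟩
  · rintro ⟨b, hb⟩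
    have hz : (K.fromOpcycles n p).unop b = z :=
      (ModuleCat.mono_iff_injective (K.pOpcycles n).unop).1 inferInstance ((hd b).symm.trans hb)
    rw [← hz, hι]

end OpHomology

section Comparison

variable {R : Type} [CommRing R] {X X' Y : ModuleCat.{0} R}

/-- `f` is a cocycle on a projective resolution representing the `Ext` class `x`. -/
def ExtRepresents (P : ProjectiveResolution X) {n : ℕ} (f : P.complex.X n ⟶ Y)
    (x : ((Ext R (ModuleCat.{0} R) n).obj (op X)).obj Y) : Prop :=
  Represents ((((linearYoneda R (ModuleCat.{0} R)).obj Y).rightOp.mapHomologicalComplex _).obj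
    P.complex) n f ((P.isoLeftDerivedObj ((linearYoneda R (ModuleCat.{0} R)).obj Y).rightOp n).inv.unop x)

variable {P : ProjectiveResolution X} {n : ℕ}

lemma ExtRepresents.exists_cocycle (P : ProjectiveResolution X)
    (x : ((Ext R (ModuleCat.{0} R) n).obj (op X)).obj Y) :
    ∃ f, P.complex.d (n + 1) n ≫ f = 0 ∧ ExtRepresents P f x := by
  obtain ⟨f, hf⟩ := Represents.exists_cocycle
    ((P.isoLeftDerivedObj ((linearYoneda R (ModuleCat.{0} R)).obj Y).rightOp n).inv.unop x)
  exact ⟨f, hf.d_eq_zero (n + 1), hf⟩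

lemma ExtRepresents.exists_class (f : P.complex.X n ⟶ Y) (hf : P.complex.d (n + 1) n ≫ f = 0) :
    ∃ x, ExtRepresents P f x := by
  obtain ⟨y, hy⟩ := Represents.exists_class
    (K := (((linearYoneda R (ModuleCat.{0} R)).obj Y).rightOp.mapHomologicalComplex _).obj
      P.complex) f (n + 1) rfl hf
  refine ⟨(P.isoLeftDerivedObj ((linearYoneda R (ModuleCat.{0} R)).obj Y).rightOp n).hom.unop y, ?_⟩
  have := congrArg (fun g => g.unop y)
    (P.isoLeftDerivedObj ((linearYoneda R (ModuleCat.{0} R)).obj Y).rightOp n).inv_hom_id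
  unfold ExtRepresents
  exact this.symm ▸ hy

lemma ExtRepresents.map {f : P.complex.X n ⟶ Y} {x} (h : ExtRepresents P f x)
    {P' : ProjectiveResolution X'} {g : X' ⟶ X} (φ : ProjectiveResolution.Hom P' P g) :
    ExtRepresents P' (φ.hom.f n ≫ f) (((Ext R (ModuleCat.{0} R) n).map g.op).app Y x) := by
  have h1 := Represents.map ((((linearYoneda R (ModuleCat.{0} R)).obj
    Y).rightOp.mapHomologicalComplex _).map φ.hom) h
  have h2 := congrArg (fun g => g.unop x) (ProjectiveResolution.isoLeftDerivedObj_inv_naturality g P' P φ.hom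
    (by rw [φ.hom_f_zero_comp_π_f_zero, ChainComplex.single₀_map_f_zero]; rfl)
    ((linearYoneda R (ModuleCat.{0} R)).obj Y).rightOp n)
  exact (congrArg (Represents _ n _) h2).mpr h1

lemma ExtRepresents.eq_zero_iff {f : P.complex.X n ⟶ Y} {x} (h : ExtRepresents P f x) (p : ℕ)
    (hp : (ComplexShape.down ℕ).next n = p) :
    x = 0 ↔ ∃ b, P.complex.d n p ≫ b = f := by
  refine Iff.trans ?_ (Represents.eq_zero_iff h p hp)
  let e := P.isoLeftDerivedObj ((linearYoneda R (ModuleCat.{0} R)).obj Y).rightOp n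
  constructor
  · intro hx
    rw [hx]
    exact map_zero e.inv.unop.hom
  · intro hx
    have := congrArg (fun g => g.unop x) e.hom_inv_id
    exact this.symm.trans ((congrArg e.hom.unop hx).trans (map_zero e.hom.unop.hom))

lemma extMk_eq_zero_iff (f : P.complex.X n ⟶ Y) (hf : P.complex.d (n + 1) n ≫ f = 0) (p : ℕ)
    (hp : (ComplexShape.down ℕ).next n = p) :
    P.extMk f (n + 1) rfl hf = 0 ↔ ∃ b, P.complex.d n p ≫ b = f := by
  cases n with
  | succ n =>
    obtain rfl : n = p := by rw [← hp, ChainComplex.next_nat_succ]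
    exact P.extMk_eq_zero_iff f _ rfl hf n rfl
  | zero =>
    obtain rfl : 0 = p := by rw [← hp, ChainComplex.next_nat_zero]
    rw [← P.extEquivCohomologyClass.apply_eq_iff_eq, P.extEquivCohomologyClass_extMk,
      P.extEquivCohomologyClass_zero, CochainComplex.HomComplex.CohomologyClass.mk_eq_zero_iff,
      CochainComplex.HomComplex.Cocycle.toSingleMk_mem_coboundaries_iff _ _ _ _ _ 1 (by simp)]
    have h0 : P.complex.d 0 0 = 0 := P.complex.shape _ _ (by simp)
    have h1 : P.cochainComplex.d (-(0 : ℕ)) 1 = 0 :=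
      (P.cochainComplex.isZero_of_isStrictlyLE 0 1 (by lia)).eq_of_tgt _ _
    simp only [h0, h1, zero_comp, exists_const]
    constructor
    · intro h
      rw [← cancel_epi (P.cochainComplexXIso (-(0 : ℕ)) 0 rfl).hom, ← h, comp_zero]
    · intro h
      rw [← h, comp_zero]

end Comparison

end

section

open Limits Opposite

section Comparison

variable {R : Type} [CommRing R] {X X' Y : ModuleCat.{0} R} {n : ℕ}

/-- The two notions of `Ext` class represented by the same cocycle. -/
lemma map_eq_zero_iff_of_extRepresents {P : ProjectiveResolution X} {f : P.complex.X n ⟶ Y}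
    (hf : P.complex.d (n + 1) n ≫ f = 0) {x} (hx : ExtRepresents P f x) (g : X' ⟶ X) :
    ((Ext R (ModuleCat.{0} R) n).map g.op).app Y x = 0 ↔
      (Abelian.Ext.mk₀ g).comp (P.extMk f (n + 1) rfl hf) (zero_add n) = 0 := by
  let P' := projectiveResolution X'
  let φ : ProjectiveResolution.Hom P' P g :=
    { hom := ProjectiveResolution.lift g P' P
      hom_f_zero_comp_π_f_zero := ProjectiveResolution.lift_commutes_zero g P' P }
  rw [ProjectiveResolution.mk₀_comp_extMk f (n + 1) rfl hf φ, extMk_eq_zero_iff _ _ _ rfl]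
  exact (hx.map φ).eq_zero_iff _ rfl

lemma exists_newExt (x : ((Ext R (ModuleCat.{0} R) n).obj (op X)).obj Y) :
    ∃ y : Abelian.Ext X Y n, ∀ (X' : ModuleCat.{0} R) (g : X' ⟶ X),
      ((Ext R (ModuleCat.{0} R) n).map g.op).app Y x = 0 ↔
        (Abelian.Ext.mk₀ g).comp y (zero_add n) = 0 := by
  obtain ⟨f, hf, hx⟩ := ExtRepresents.exists_cocycle (projectiveResolution X) x
  exact ⟨_, fun X' g => map_eq_zero_iff_of_extRepresents hf hx g⟩

lemma exists_oldExt (y : Abelian.Ext X Y n) :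
    ∃ x : ((Ext R (ModuleCat.{0} R) n).obj (op X)).obj Y, ∀ (X' : ModuleCat.{0} R) (g : X' ⟶ X),
      ((Ext R (ModuleCat.{0} R) n).map g.op).app Y x = 0 ↔
        (Abelian.Ext.mk₀ g).comp y (zero_add n) = 0 := by
  obtain ⟨f, hf, rfl⟩ := (projectiveResolution X).extMk_surjective y (n + 1) rfl
  obtain ⟨x, hx⟩ := ExtRepresents.exists_class f hf
  exact ⟨x, fun X' g => map_eq_zero_iff_of_extRepresents hf hx g⟩

end Comparison

section Colimit

variable {R : Type} [CommRing R]

lemma subsingleton_iff_of_isColimit {J : Type} [SmallCategory J] [IsFiltered J]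
    {F : J ⥤ ModuleCat.{0} R} {c : Cocone F} (hc : IsColimit c) :
    Subsingleton c.pt ↔ ∀ (i : J) (x : F.obj i), ∃ (k : J) (f : i ⟶ k), F.map f x = 0 := by
  constructor
  · intro h i x
    obtain ⟨k, f, g, hk⟩ := Concrete.isColimit_exists_of_rep_eq F hc x (0 : F.obj i)
      (h.elim _ _)
    exact ⟨k, f, hk.trans (map_zero _)⟩
  · intro h
    refine subsingleton_of_forall_eq 0 fun x => ?_
    obtain ⟨i, x, rfl⟩ := Concrete.isColimit_exists_rep F hc x
    obtain ⟨k, f, hk⟩ := h i x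
    rw [← c.w f, ModuleCat.comp_apply, hk, map_zero]

lemma LC.subsingleton_iff {I : Ideal R} {j : ℕ} {M : ModuleCat.{0} R} :
    Subsingleton (LC I j M) ↔ ∀ (n : ℕ) (x : Abelian.Ext (ModuleCat.of R (R ⧸ I ^ n)) M j),
      ∃ (m : ℕ) (h : n ≤ m), trans I j M n m h x = 0 := by
  constructor
  · intro h n x
    exact (LC.of_eq_zero_iff _).1 (Subsingleton.elim (LC.of I j M n x) 0)
  · intro h
    refine subsingleton_of_forall_eq 0 fun x => ?_
    obtain ⟨n, c, rfl⟩ := x.exists_of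
    exact (LC.of_eq_zero_iff _).2 (h n c)

lemma subsingleton_localCohomology_iff (I : Ideal R) (j : ℕ) (M : ModuleCat.{0} R) :
    Subsingleton ((localCohomology I j).obj M) ↔ Subsingleton (LC I j M) := by
  have := localCohomology.hasColimitDiagram.{0, 0} (localCohomology.idealPowersDiagram I) j
  let D := localCohomology.diagram (localCohomology.idealPowersDiagram I) j
  have hc := isColimitOfPreserves ((evaluation (ModuleCat.{0} R) (ModuleCat.{0} R)).obj M)
    (colimit.isColimit D)
  refine (subsingleton_iff_of_isColimit hc).trans (Iff.trans ?_ LC.subsingleton_iff.symm)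
  constructor
  · intro h n y
    obtain ⟨x, hx⟩ := exists_oldExt y
    obtain ⟨m, f, hm⟩ := h (op (op n)) x
    refine ⟨m.unop.unop, leOfHom f.unop.unop, ?_⟩
    rw [trans_apply, ← hx]
    exact hm
  · intro h n x
    obtain ⟨y, hy⟩ := exists_newExt x
    obtain ⟨m, hnm, hm⟩ := h n.unop.unop y
    refine ⟨op (op m), (homOfLE hnm).op.op, ?_⟩
    exact (hy _ (powProj I hnm)).2 hm

end Colimit

end

end HartshorneLichtenbaum

/-- **Hartshorne–Lichtenbaum vanishing.** Let `(A, 𝔪)` be a Noetherian local ring of Krull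
dimension `d` and `I` a proper ideal.  Then `H^d_I(A) = 0` if and only if for every minimal
prime `P` of the `𝔪`-adic completion `Â` with `dim (Â/P) = d` one has `dim (Â/(IÂ + P)) > 0`.
In particular, if `A` is a complete local domain and `√I ≠ 𝔪` then `H^d_I(A) = 0`. -/
theorem hartshorne_lichtenbaum_vanishing
    (A : Type) [CommRing A] [IsNoetherianRing A] [IsLocalRing A]
    (I : Ideal A) (hI : I ≠ ⊤)
    (d : ℕ) (hd : (d : WithBot ℕ∞) = ringKrullDim A) :
    (Subsingleton ((localCohomology I d).obj (ModuleCat.of A A)) ↔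
      ∀ P ∈ minimalPrimes (AdicCompletion (IsLocalRing.maximalIdeal A) A),
        (d : WithBot ℕ∞) = ringKrullDim (AdicCompletion (IsLocalRing.maximalIdeal A) A ⧸ P) →
          0 < ringKrullDim (AdicCompletion (IsLocalRing.maximalIdeal A) A ⧸
            (Ideal.map (algebraMap A (AdicCompletion (IsLocalRing.maximalIdeal A) A)) I ⊔ P))) ∧
    (IsDomain A → IsAdicComplete (IsLocalRing.maximalIdeal A) A →
      I.radical ≠ IsLocalRing.maximalIdeal A →
        Subsingleton ((localCohomology I d).obj (ModuleCat.of A A))) := by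
  refine ⟨?_, fun _ _ h => ?_⟩
  · rw [HartshorneLichtenbaum.subsingleton_localCohomology_iff]
    exact HartshorneLichtenbaum.LC.subsingleton_iff_adicCompletion I hI d hd
  · rw [HartshorneLichtenbaum.subsingleton_localCohomology_iff]
    exact HartshorneLichtenbaum.LC.subsingleton_of_isDomain I hI d hd h
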